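/- arXiv:2409.04970 — 9 statements merged into one kernel-verified Lean document; each statement's English description precedes it below -/
import Mathlib

section
/- Let n ≥ 1 be a natural number, σ > 0, x̄, γ ∈ ℝ, κ, p ∈ ℝ, and set σ_n² = σ²/n and σ_φ² = σ^p/n^κ. Let π(μ) = (2π σ_n²)^(−1/2) exp(−(μ−x̄)²/(2σ_n²)) be the density of N(x̄, σ_n²). Suppose C > 0 satisfies ∫_ℝ C·exp(−(μ−γ)²/(2σ_φ²))·π(μ) dμ = 1 and set φ(μ) = C·exp(−(μ−γ)²/(2σ_φ²)). Then the information gain Δ = h(π) − h^φ(π) equals (1/2)·σ^(2−p)·n^κ/(σ^(2−p)·n^κ + n) − (1/2)·((γ−x̄)²·n/σ²)·(σ^(2−p)·n^κ/(σ^(2−p)·n^κ + n))². -/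
open MeasureTheory

lemma aux_gauss_quad (m b A B v : ℝ) (hv : 0 < v) :
    ∫ x, ProbabilityTheory.gaussianPDFReal m v.toNNReal x * (A + B * (x - b) ^ 2)
      = A + B * (v + (m - b) ^ 2) := by
  have hv0 : v.toNNReal ≠ 0 := by simpa using hv
  have h := ProbabilityTheory.integral_gaussianReal_eq_integral_smul (μ := m) (v := v.toNNReal)
    (f := fun x => A + B * (x - b) ^ 2) hv0
  simp only [smul_eq_mul] at h
  rw [← h]
  set P := ProbabilityTheory.gaussianReal m v.toNNReal with hP
  have hL : MemLp id 2 P := ProbabilityTheory.memLp_id_gaussianReal' 2 (by simp)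
  have hi1 : Integrable (fun x : ℝ => x) P := hL.integrable (by norm_num)
  have hi2 : Integrable (fun x : ℝ => x ^ 2) P := by simpa using hL.integrable_sq
  have e1 : ∫ x, x ∂P = m := ProbabilityTheory.integral_id_gaussianReal
  have hvar : ProbabilityTheory.variance id P = v := by
    rw [hP, ProbabilityTheory.variance_id_gaussianReal]
    simp [hv.le]
  have e2 : ∫ x, x ^ 2 ∂P = v + m ^ 2 := by
    rw [ProbabilityTheory.variance_eq_sub hL] at hvar
    simp only [Pi.pow_apply, id] at hvar
    rw [e1] at hvar
    linarith
  have : ∀ x : ℝ, A + B * (x - b) ^ 2 = (A + B * b ^ 2) + ((-2 * B * b) * x + B * x ^ 2) := by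
    intro x; ring
  simp only [this]
  have hi3 : Integrable (fun x : ℝ => (-2 * B * b) * x + B * x ^ 2) P :=
    (hi1.const_mul _).add (hi2.const_mul _)
  rw [integral_add (integrable_const _) hi3,
    integral_add (hi1.const_mul _) (hi2.const_mul _), integral_const_mul, integral_const_mul, e1, e2]
  simp
  ring

/-- Theorem 1 of the paper: closed-form expression for the information gain
`Δ = h(π) − h^φ(π)` for a Gaussian-kernel weight function centered at the target `γ`
with variance `σ^p / n^κ`, where `π` is the `N(x̄, σ²/n)` posterior density. -/
theorem information_gain_symmetric_weight
    (n : ℕ) (hn : 1 ≤ n) (σ xb γ κ p : ℝ) (hσ : 0 < σ)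
    (σn2 σφ2 : ℝ)
    (hσn2 : σn2 = σ ^ 2 / n)
    (hσφ2 : σφ2 = σ ^ p / (n : ℝ) ^ κ)
    (f : ℝ → ℝ)
    (hf : ∀ μ : ℝ, f μ =
      (2 * Real.pi * σn2) ^ (-(1 / 2) : ℝ) * Real.exp (-(μ - xb) ^ 2 / (2 * σn2)))
    (C : ℝ) (hC : 0 < C)
    (w : ℝ → ℝ)
    (hw : ∀ μ : ℝ, w μ = C * Real.exp (-(μ - γ) ^ 2 / (2 * σφ2)))
    (hnorm : ∫ μ : ℝ, w μ * f μ = 1) :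
    (-∫ μ : ℝ, f μ * Real.log (f μ)) - (-∫ μ : ℝ, w μ * f μ * Real.log (f μ))
      = 1 / 2 * (σ ^ ((2 : ℝ) - p) * (n : ℝ) ^ κ) / (σ ^ ((2 : ℝ) - p) * (n : ℝ) ^ κ + n)
        - 1 / 2 * ((γ - xb) ^ 2 * n / σ ^ 2)
          * ((σ ^ ((2 : ℝ) - p) * (n : ℝ) ^ κ)
              / (σ ^ ((2 : ℝ) - p) * (n : ℝ) ^ κ + n)) ^ 2 := by
  have hn0 : (0 : ℝ) < n := by exact_mod_cast hn
  have hs : 0 < σn2 := by rw [hσn2]; positivity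
  have ht : 0 < σφ2 := by rw [hσφ2]; positivity
  have hR : (σ ^ ((2 : ℝ) - p) * (n : ℝ) ^ κ) / (σ ^ ((2 : ℝ) - p) * (n : ℝ) ^ κ + n)
      = σn2 / (σn2 + σφ2) := by
    have h1 : σ ^ ((2 : ℝ) - p) = σ ^ 2 / σ ^ p := by
      rw [Real.rpow_sub hσ]; norm_num
    have h2 : 0 < σ ^ p := by positivity
    have h3 : 0 < (n : ℝ) ^ κ := by positivity
    rw [h1, hσn2, hσφ2]
    generalize σ ^ p = a at *
    generalize (n : ℝ) ^ κ = c at *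
    field_simp
  have hS : (γ - xb) ^ 2 * n / σ ^ 2 = (γ - xb) ^ 2 / σn2 := by
    rw [hσn2]; field_simp
  rw [mul_div_assoc, hR, hS]
  clear hR hS hσn2 hσφ2
  have hc : 0 < (2 * Real.pi * σn2) ^ (-(1 / 2) : ℝ) := by positivity
  have hlog : ∀ x, Real.log (f x) = Real.log ((2 * Real.pi * σn2) ^ (-(1 / 2) : ℝ))
      + (-1 / (2 * σn2)) * (x - xb) ^ 2 := by
    intro x
    rw [hf, Real.log_mul hc.ne' (Real.exp_pos _).ne', Real.log_exp]
    ring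
  have hfg : ∀ x, f x = ProbabilityTheory.gaussianPDFReal xb σn2.toNNReal x := by
    intro x
    rw [hf, ProbabilityTheory.gaussianPDFReal, Real.coe_toNNReal _ hs.le,
      Real.rpow_neg (by positivity), Real.sqrt_eq_rpow]
  set v := σn2 * σφ2 / (σn2 + σφ2) with hv
  have hv0 : 0 < v := by positivity
  set m := (σφ2 * xb + σn2 * γ) / (σn2 + σφ2) with hm
  obtain ⟨K, hK⟩ : ∃ K : ℝ, ∀ x, w x * f x
      = K * ProbabilityTheory.gaussianPDFReal m v.toNNReal x := by
    refine ⟨C * (2 * Real.pi * σn2) ^ (-(1 / 2) : ℝ) * √(2 * Real.pi * v)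
      * Real.exp (-(γ - xb) ^ 2 / (2 * (σn2 + σφ2))), fun x => ?_⟩
    rw [hw, hf, ProbabilityTheory.gaussianPDFReal, Real.coe_toNNReal _ hv0.le]
    have hq : √(2 * Real.pi * v) ≠ 0 := by positivity
    have he : Real.exp (-(x - γ) ^ 2 / (2 * σφ2)) * Real.exp (-(x - xb) ^ 2 / (2 * σn2))
        = Real.exp (-(γ - xb) ^ 2 / (2 * (σn2 + σφ2))) * Real.exp (-(x - m) ^ 2 / (2 * v)) := by
      rw [← Real.exp_add, ← Real.exp_add]
      congr 1
      rw [hm, hv]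
      field_simp
      ring
    generalize (2 * Real.pi * σn2) ^ (-(1 / 2) : ℝ) = c at *
    calc _ = C * c * (Real.exp (-(x - γ) ^ 2 / (2 * σφ2))
          * Real.exp (-(x - xb) ^ 2 / (2 * σn2))) := by ring
      _ = _ := by rw [he]; field_simp
  have hK1 : K = 1 := by
    simp only [hK] at hnorm
    rw [integral_const_mul, ProbabilityTheory.integral_gaussianPDFReal_eq_one _
      (by simpa using hv0)] at hnorm
    simpa using hnorm
  simp only [hK, hK1, one_mul, hlog]
  rw [aux_gauss_quad _ _ _ _ _ hv0]
  simp only [hfg]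
  rw [aux_gauss_quad _ _ _ _ _ hs, hm, hv]
  field_simp
  ring
end

section
/- Fix σ > 0, γ ∈ ℝ, p ∈ ℝ and 0 < κ < 1. For n ≥ 1 and x ∈ ℝ define Δ_n(x) = (1/2)·σ^(2−p)·n^κ/(σ^(2−p)·n^κ + n) − (1/2)·((γ−x)²·n/σ²)·(σ^(2−p)·n^κ/(σ^(2−p)·n^κ + n))². If (x̄_n)_{n≥1} is a real sequence with x̄_n → m ∈ ℝ, then the sequence Δ_n(x̄_n) is O(n^(2κ−1)) as n → ∞. -/
open Filter Asymptotics

/-- Asymptotics of the information gain when `0 < κ < 1`: along any sequence of sample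
means converging to `m`, the information gain is `O(n^(2κ−1))` as `n → ∞`. -/
theorem information_gain_isBigO_of_kappa_lt_one
    (σ γ p κ : ℝ) (hσ : 0 < σ) (hκ0 : 0 < κ) (hκ1 : κ < 1)
    (Δ : ℕ → ℝ → ℝ)
    (hΔ : ∀ n : ℕ, 1 ≤ n → ∀ x : ℝ,
      Δ n x = 1 / 2 * (σ ^ ((2 : ℝ) - p) * (n : ℝ) ^ κ) / (σ ^ ((2 : ℝ) - p) * (n : ℝ) ^ κ + n)
        - 1 / 2 * ((γ - x) ^ 2 * n / σ ^ 2)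
          * ((σ ^ ((2 : ℝ) - p) * (n : ℝ) ^ κ)
              / (σ ^ ((2 : ℝ) - p) * (n : ℝ) ^ κ + n)) ^ 2)
    (xbar : ℕ → ℝ) (m : ℝ) (hx : Tendsto xbar atTop (nhds m)) :
    (fun n : ℕ => Δ n (xbar n)) =O[atTop] (fun n : ℕ => (n : ℝ) ^ (2 * κ - 1)) := by
  have hlim : Tendsto (fun n => (γ - xbar n) ^ 2) atTop (nhds ((γ - m) ^ 2)) :=
    (tendsto_const_nhds.sub hx).pow 2
  have hev : ∀ᶠ n in atTop, (γ - xbar n) ^ 2 < (γ - m) ^ 2 + 1 :=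
    hlim.eventually_lt_const (by linarith)
  generalize hM : (γ - m) ^ 2 + 1 = M at hev
  have hc : 0 < σ ^ ((2 : ℝ) - p) := Real.rpow_pos_of_pos hσ _
  generalize σ ^ ((2 : ℝ) - p) = c at hΔ hc
  refine IsBigO.of_bound (1 / 2 * c + 1 / 2 * (M / σ ^ 2) * c ^ 2) ?_
  filter_upwards [hev, eventually_ge_atTop 1] with n hn hn1
  rw [hΔ n hn1]
  have hN : (1 : ℝ) ≤ n := by exact_mod_cast hn1
  generalize (n : ℝ) = N at hN
  have hN0 : 0 < N := by linarith
  have hT : N ^ (2 * κ - 1) = (N ^ κ) ^ 2 / N := by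
    rw [Real.rpow_sub hN0, Real.rpow_one, mul_comm, Real.rpow_mul hN0.le]
    norm_num
  have ht : 1 ≤ N ^ κ := Real.one_le_rpow hN hκ0.le
  rw [hT]
  generalize N ^ κ = t at ht
  have ht0 : 0 < t := by linarith
  have hM0 : 0 ≤ M := by rw [← hM]; positivity
  have hq0 : 0 ≤ c * t / (c * t + N) := by positivity
  have hq : c * t / (c * t + N) ≤ c * t / N := by
    apply div_le_div_of_nonneg_left <;> first | positivity | nlinarith [mul_pos hc ht0]
  have h1 : c * t / N ≤ c * (t ^ 2 / N) := by
    rw [mul_div_assoc]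
    gcongr
    nlinarith
  have h2 : 1 / 2 * ((γ - xbar n) ^ 2 * N / σ ^ 2) * (c * t / (c * t + N)) ^ 2
      ≤ 1 / 2 * (M * N / σ ^ 2) * (c * t / N) ^ 2 := by
    gcongr
  have h3 : 1 / 2 * (M * N / σ ^ 2) * (c * t / N) ^ 2
      = 1 / 2 * (M / σ ^ 2) * c ^ 2 * (t ^ 2 / N) := by
    field_simp
  have h4 : 0 ≤ 1 / 2 * ((γ - xbar n) ^ 2 * N / σ ^ 2) * (c * t / (c * t + N)) ^ 2 := by
    positivity
  have h5 : 0 ≤ 1 / 2 * (M / σ ^ 2) * c ^ 2 * (t ^ 2 / N) := by positivity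
  have h6 : 0 ≤ c * (t ^ 2 / N) := by positivity
  rw [mul_div_assoc, Real.norm_eq_abs, Real.norm_eq_abs, abs_of_nonneg (a := t ^ 2 / N) (by positivity),
    abs_le]
  constructor <;> linarith
end

section
/- Fix σ > 0, γ ∈ ℝ, p ∈ ℝ and κ = 1/2. For n ≥ 1 and x ∈ ℝ define Δ_n(x) = (1/2)·σ^(2−p)·n^(1/2)/(σ^(2−p)·n^(1/2) + n) − (1/2)·((γ−x)²·n/σ²)·(σ^(2−p)·n^(1/2)/(σ^(2−p)·n^(1/2) + n))². If (x̄_n)_{n≥1} is a real sequence with x̄_n → m ∈ ℝ, then Δ_n(x̄_n) converges to the finite limit −(1/2)·(γ−m)²·σ^(2−2p) as n → ∞; in particular, for p = 1 the limit is −(1/2)(γ−m)² and for p = 2 it is −(1/2)((γ−m)/σ)². -/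
open Filter

/-- When `κ = 1/2`, the information gain converges to the finite limit
`−(1/2)·(γ−m)²·σ^(2−2p)`; in particular for `p = 1` the limit is `−(1/2)(γ−m)²` and
for `p = 2` it is `−(1/2)((γ−m)/σ)²`. -/
theorem information_gain_tendsto_of_kappa_eq_half
    (σ γ p : ℝ) (hσ : 0 < σ)
    (Δ : ℕ → ℝ → ℝ)
    (hΔ : ∀ n : ℕ, 1 ≤ n → ∀ x : ℝ,
      Δ n x = 1 / 2 * (σ ^ ((2 : ℝ) - p) * (n : ℝ) ^ ((1 : ℝ) / 2))
            / (σ ^ ((2 : ℝ) - p) * (n : ℝ) ^ ((1 : ℝ) / 2) + n)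
        - 1 / 2 * ((γ - x) ^ 2 * n / σ ^ 2)
          * ((σ ^ ((2 : ℝ) - p) * (n : ℝ) ^ ((1 : ℝ) / 2))
              / (σ ^ ((2 : ℝ) - p) * (n : ℝ) ^ ((1 : ℝ) / 2) + n)) ^ 2)
    (xbar : ℕ → ℝ) (m : ℝ) (hx : Tendsto xbar atTop (nhds m)) :
    Tendsto (fun n : ℕ => Δ n (xbar n))
        atTop (nhds (-(1 / 2) * (γ - m) ^ 2 * σ ^ ((2 : ℝ) - 2 * p)))
    ∧ (p = 1 → -(1 / 2) * (γ - m) ^ 2 * σ ^ ((2 : ℝ) - 2 * p)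
        = -(1 / 2) * (γ - m) ^ 2)
    ∧ (p = 2 → -(1 / 2) * (γ - m) ^ 2 * σ ^ ((2 : ℝ) - 2 * p)
        = -(1 / 2) * ((γ - m) / σ) ^ 2) := by
  have hpow : σ ^ ((2 : ℝ) - 2 * p) = (σ ^ ((2 : ℝ) - p)) ^ 2 / σ ^ 2 := by
    rw [← Real.rpow_natCast (σ ^ ((2 : ℝ) - p)), ← Real.rpow_mul hσ.le,
      ← Real.rpow_natCast σ 2, ← Real.rpow_sub hσ]
    congr 1
    push_cast
    ring
  refine ⟨?_, ?_, ?_⟩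
  · rw [hpow]
    have ha : 0 < σ ^ ((2 : ℝ) - p) := Real.rpow_pos_of_pos hσ _
    generalize σ ^ ((2 : ℝ) - p) = a at *
    have hu : Tendsto (fun n : ℕ => (Real.sqrt (n : ℝ))⁻¹) atTop (nhds 0) :=
      tendsto_inv_atTop_zero.comp (Real.tendsto_sqrt_atTop.comp tendsto_natCast_atTop_atTop)
    have hden : Tendsto (fun n : ℕ => a * (Real.sqrt (n : ℝ))⁻¹ + 1) atTop
        (nhds (a * 0 + 1)) := (hu.const_mul a).add_const 1
    have hne : a * 0 + 1 ≠ 0 := by simp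
    have key := ((((hu.const_mul a).div hden hne).const_mul (1 / 2))).sub
      (((((hx.const_sub γ).pow 2).div_const (σ ^ 2)).const_mul (1 / 2)).mul
        (((tendsto_const_nhds (x := a)).div hden hne).pow 2))
    have hlim : 1 / 2 * (a * 0 / (a * 0 + 1)) -
        1 / 2 * ((γ - m) ^ 2 / σ ^ 2) * (a / (a * 0 + 1)) ^ 2
        = -(1 / 2) * (γ - m) ^ 2 * (a ^ 2 / σ ^ 2) := by
      simp only [mul_zero, zero_add, div_one, zero_div]
      ring
    rw [hlim] at key
    refine key.congr' ?_
    filter_upwards [eventually_ge_atTop 1] with n hn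
    rw [hΔ n hn, ← Real.sqrt_eq_rpow]
    simp only [Pi.div_apply]
    have hn0 : (0 : ℝ) < n := by exact_mod_cast hn
    have hs : 0 < Real.sqrt (n : ℝ) := Real.sqrt_pos.mpr hn0
    have hsq : (n : ℝ) = Real.sqrt (n : ℝ) ^ 2 := (Real.sq_sqrt hn0.le).symm
    generalize Real.sqrt (n : ℝ) = s at *
    rw [hsq]
    have h1 : a * s + s ^ 2 = s ^ 2 * (a * s⁻¹ + 1) := by field_simp
    have h2 : 0 < a * s⁻¹ + 1 := by positivity
    rw [h1]
    generalize hd : a * s⁻¹ + 1 = d at *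
    field_simp
  · rintro rfl
    norm_num
  · rintro rfl
    rw [hpow]
    norm_num
    ring
end

section
/- Fix σ > 0, γ ∈ ℝ, p ∈ ℝ and κ > 1/2. For n ≥ 1 and x ∈ ℝ define Δ_n(x) = (1/2)·σ^(2−p)·n^κ/(σ^(2−p)·n^κ + n) − (1/2)·((γ−x)²·n/σ²)·(σ^(2−p)·n^κ/(σ^(2−p)·n^κ + n))². If (x̄_n)_{n≥1} is a real sequence converging to some m ∈ ℝ with m ≠ γ, then Δ_n(x̄_n) → −∞ as n → ∞. -/
open Filter

/-- When `κ > 1/2` and the sample means converge to some `m ≠ γ`, the information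
gain diverges to `−∞`. -/
theorem information_gain_tendsto_atBot_of_kappa_gt_half
    (σ γ p κ : ℝ) (hσ : 0 < σ) (hκ : 1 / 2 < κ)
    (Δ : ℕ → ℝ → ℝ)
    (hΔ : ∀ n : ℕ, 1 ≤ n → ∀ x : ℝ,
      Δ n x = 1 / 2 * (σ ^ ((2 : ℝ) - p) * (n : ℝ) ^ κ) / (σ ^ ((2 : ℝ) - p) * (n : ℝ) ^ κ + n)
        - 1 / 2 * ((γ - x) ^ 2 * n / σ ^ 2)
          * ((σ ^ ((2 : ℝ) - p) * (n : ℝ) ^ κ)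
              / (σ ^ ((2 : ℝ) - p) * (n : ℝ) ^ κ + n)) ^ 2)
    (xbar : ℕ → ℝ) (m : ℝ) (hm : m ≠ γ) (hx : Tendsto xbar atTop (nhds m)) :
    Tendsto (fun n : ℕ => Δ n (xbar n)) atTop atBot := by
  obtain ⟨s, hs, hs1, hsκ⟩ : ∃ s : ℝ, 1 / 2 < s ∧ s ≤ 1 ∧ s ≤ κ :=
    ⟨min κ 1, lt_min hκ (by norm_num), min_le_right _ _, min_le_left _ _⟩
  have hc : 0 < σ ^ ((2 : ℝ) - p) := Real.rpow_pos_of_pos hσ _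
  generalize σ ^ ((2 : ℝ) - p) = c at hc hΔ
  have h1 : Tendsto (fun n : ℕ => (n : ℝ) ^ (2 * s - 1)) atTop atTop :=
    (tendsto_rpow_atTop (by linarith)).comp tendsto_natCast_atTop_atTop
  have h2 : Tendsto (fun n : ℕ => 1 / 2 * ((γ - xbar n) ^ 2 / σ ^ 2) * (c / (c + 1)) ^ 2) atTop
      (nhds (1 / 2 * ((γ - m) ^ 2 / σ ^ 2) * (c / (c + 1)) ^ 2)) :=
    (((((tendsto_const_nhds.sub hx).pow 2).div_const _).const_mul _).mul_const _)
  have hpos : 0 < 1 / 2 * ((γ - m) ^ 2 / σ ^ 2) * (c / (c + 1)) ^ 2 := by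
    have : 0 < (γ - m) ^ 2 := by
      have := sub_ne_zero.mpr hm.symm
      positivity
    positivity
  have h3 := h2.pos_mul_atTop hpos h1
  have h4 := tendsto_atBot_add_const_left atTop (1 / 2 : ℝ) (tendsto_neg_atTop_atBot.comp h3)
  refine tendsto_atBot_mono' atTop ?_ h4
  filter_upwards [eventually_ge_atTop 1] with n hn
  rw [hΔ n hn]
  have hn1 : (1 : ℝ) ≤ n := by exact_mod_cast hn
  have hn0 : (0 : ℝ) < n := by linarith
  have hBA : (n : ℝ) ^ s ≤ (n : ℝ) ^ κ := Real.rpow_le_rpow_of_exponent_le hn1 hsκ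
  have hBn : (n : ℝ) ^ s ≤ n := by
    simpa using Real.rpow_le_rpow_of_exponent_le hn1 hs1
  have hB : 0 < (n : ℝ) ^ s := Real.rpow_pos_of_pos hn0 _
  have hE : (n : ℝ) ^ (2 * s - 1) = ((n : ℝ) ^ s) ^ 2 / n := by
    rw [Real.rpow_sub hn0, Real.rpow_one, two_mul, Real.rpow_add hn0, sq]
  simp only [Function.comp, hE]
  generalize (n : ℝ) ^ s = B at *
  generalize (n : ℝ) ^ κ = A at *
  generalize (n : ℝ) = N at *
  have hA : 0 < A := by linarith
  have hw : c / (c + 1) * (B / N) ≤ c * A / (c * A + N) := by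
    rw [div_mul_div_comm, div_le_div_iff₀ (by positivity) (by positivity)]
    have e1 : c * (A * B) ≤ c * (A * N) := by gcongr
    have e2 : B * N ≤ A * N := by gcongr
    have e3 : c * (c * (A * B) + B * N) ≤ c * (c * (A * N) + A * N) := by gcongr
    linarith
  have hw1 : c * A / (c * A + N) ≤ 1 := by
    rw [div_le_one (by positivity)]; linarith
  have hsq : (c / (c + 1) * (B / N)) ^ 2 ≤ (c * A / (c * A + N)) ^ 2 := by gcongr
  have hfin := mul_le_mul_of_nonneg_left hsq
    (show 0 ≤ 1 / 2 * ((γ - xbar n) ^ 2 * N / σ ^ 2) by positivity)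
  have he : 1 / 2 * ((γ - xbar n) ^ 2 * N / σ ^ 2) * (c / (c + 1) * (B / N)) ^ 2
      = 1 / 2 * ((γ - xbar n) ^ 2 / σ ^ 2) * (c / (c + 1)) ^ 2 * (B ^ 2 / N) := by
    field_simp
  rw [he] at hfin
  rw [mul_div_assoc (1 / 2 : ℝ) (c * A)]
  linarith
end

section
/- Let σ_n > 0, σ_φ > 0 and x̄, γ ∈ ℝ. Define μ̃ = (γ·σ_n² + x̄·σ_φ²)/(σ_n² + σ_φ²), σ̃² = (σ_n²·σ_φ²)/(σ_n² + σ_φ²), π(μ) = (2π σ_n²)^(−1/2) exp(−(μ−x̄)²/(2σ_n²)), and let φ(μ) = C·exp(−(μ−γ)²/(2σ_φ²)) with C > 0 chosen so that ∫_ℝ φ·π = 1. Then the weighted Shannon entropy satisfies h^φ(π) = −∫_ℝ φ(μ)π(μ) log π(μ) dμ = (1/2)·log(2π σ_n²) + (σ̃² + (μ̃ − x̄)²)/(2σ_n²). -/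
open MeasureTheory

/-- Value of the weighted Shannon entropy `h^φ(π) = −∫ φ·π·log π` for the normal
posterior `π = N(x̄, σn²)` and the normalized Gaussian-kernel weight `φ` centered at `γ`. -/
theorem weighted_entropy_value
    (σn σφ xb γ : ℝ) (hσn : 0 < σn) (hσφ : 0 < σφ)
    (μt σt2 : ℝ)
    (hμt : μt = (γ * σn ^ 2 + xb * σφ ^ 2) / (σn ^ 2 + σφ ^ 2))
    (hσt2 : σt2 = σn ^ 2 * σφ ^ 2 / (σn ^ 2 + σφ ^ 2))
    (f : ℝ → ℝ)
    (hf : ∀ μ : ℝ, f μ =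
      (2 * Real.pi * σn ^ 2) ^ (-(1 / 2) : ℝ) * Real.exp (-(μ - xb) ^ 2 / (2 * σn ^ 2)))
    (C : ℝ) (hC : 0 < C)
    (w : ℝ → ℝ)
    (hw : ∀ μ : ℝ, w μ = C * Real.exp (-(μ - γ) ^ 2 / (2 * σφ ^ 2)))
    (hnorm : ∫ μ : ℝ, w μ * f μ = 1) :
    -∫ μ : ℝ, w μ * f μ * Real.log (f μ)
      = 1 / 2 * Real.log (2 * Real.pi * σn ^ 2) + (σt2 + (μt - xb) ^ 2) / (2 * σn ^ 2) := by
  have hS : 0 < σn ^ 2 + σφ ^ 2 := by positivity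
  have hσtpos : 0 < σt2 := by rw [hσt2]; positivity
  have hP : 0 < 2 * Real.pi * σn ^ 2 := by positivity
  obtain ⟨v, hv⟩ : ∃ v : NNReal, (v : ℝ) = σt2 := ⟨⟨σt2, hσtpos.le⟩, rfl⟩
  have hv0 : v ≠ 0 := by
    rintro rfl
    simp at hv
    linarith
  have hexp : ∀ x : ℝ, -(x - γ) ^ 2 / (2 * σφ ^ 2) + -(x - xb) ^ 2 / (2 * σn ^ 2)
      = -(γ - xb) ^ 2 / (2 * (σn ^ 2 + σφ ^ 2)) + -(x - μt) ^ 2 / (2 * σt2) := by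
    intro x
    rw [hμt, hσt2]
    field_simp
    ring
  obtain ⟨K, hK⟩ : ∃ K : ℝ, ∀ x, w x * f x = K * ProbabilityTheory.gaussianPDFReal μt v x := by
    refine ⟨C * (2 * Real.pi * σn ^ 2) ^ (-(1 / 2) : ℝ) *
      Real.exp (-(γ - xb) ^ 2 / (2 * (σn ^ 2 + σφ ^ 2))) * √(2 * Real.pi * σt2), fun x => ?_⟩
    have hs : √(2 * Real.pi * σt2) ≠ 0 := by positivity
    have h := congrArg Real.exp (hexp x)
    rw [Real.exp_add, Real.exp_add] at h
    rw [hw, hf, ProbabilityTheory.gaussianPDFReal, hv]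
    calc _ = C * (2 * Real.pi * σn ^ 2) ^ (-(1 / 2) : ℝ) *
          (Real.exp (-(x - γ) ^ 2 / (2 * σφ ^ 2)) * Real.exp (-(x - xb) ^ 2 / (2 * σn ^ 2))) := by
            ring
      _ = _ := by
        rw [h]
        field_simp
  have hK1 : K = 1 := by
    simp_rw [hK] at hnorm
    rwa [integral_const_mul, ProbabilityTheory.integral_gaussianPDFReal_eq_one μt hv0, mul_one]
      at hnorm
  have hlog : ∀ x, Real.log (f x) = -(1 / 2 * Real.log (2 * Real.pi * σn ^ 2))
      - (x ^ 2 - 2 * xb * x + xb ^ 2) / (2 * σn ^ 2) := by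
    intro x
    rw [hf, Real.log_mul (by positivity) (by positivity), Real.log_exp, Real.log_rpow hP]
    ring
  have hint : ∫ x, w x * f x * Real.log (f x)
      = ∫ x, Real.log (f x) ∂(ProbabilityTheory.gaussianReal μt v) := by
    rw [ProbabilityTheory.integral_gaussianReal_eq_integral_smul hv0]
    simp [hK, hK1]
  have hm2 : MemLp (fun x : ℝ => x) 2 (ProbabilityTheory.gaussianReal μt v) :=
    ProbabilityTheory.memLp_id_gaussianReal 2
  have hi1 : Integrable (fun x : ℝ => x) (ProbabilityTheory.gaussianReal μt v) :=
    hm2.integrable (by norm_num)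
  have hi2 : Integrable (fun x : ℝ => x ^ 2) (ProbabilityTheory.gaussianReal μt v) :=
    hm2.integrable_sq
  have hvar := ProbabilityTheory.variance_eq_sub hm2
  rw [ProbabilityTheory.variance_fun_id_gaussianReal,
    ProbabilityTheory.integral_id_gaussianReal, hv] at hvar
  have hsq : ∫ x, x ^ 2 ∂(ProbabilityTheory.gaussianReal μt v) = σt2 + μt ^ 2 := by
    have : ∫ x, x ^ 2 ∂(ProbabilityTheory.gaussianReal μt v)
      = ∫ x, ((fun x : ℝ => x) ^ 2) x ∂(ProbabilityTheory.gaussianReal μt v) := rfl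
    rw [this]
    linarith
  rw [hint]
  simp_rw [hlog]
  have hi3 : Integrable (fun x : ℝ => x ^ 2 - 2 * xb * x)
    (ProbabilityTheory.gaussianReal μt v) := hi2.sub (hi1.const_mul _)
  have hi4 : Integrable (fun x : ℝ => (x ^ 2 - 2 * xb * x + xb ^ 2) / (2 * σn ^ 2))
    (ProbabilityTheory.gaussianReal μt v) := (hi3.add (integrable_const _)).div_const _
  rw [integral_sub (integrable_const _) hi4,
    integral_div, integral_add hi3 (integrable_const _), integral_sub hi2 (hi1.const_mul _),
    integral_const_mul, hsq, ProbabilityTheory.integral_id_gaussianReal]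
  simp only [integral_const, probReal_univ, one_smul]
  ring
end

section
/- Let σ_n > 0, σ_φ > 0 and x̄, γ ∈ ℝ. Define μ̃ = (γ·σ_n² + x̄·σ_φ²)/(σ_n² + σ_φ²), σ̃² = (σ_n²·σ_φ²)/(σ_n² + σ_φ²), π(μ) = (2π σ_n²)^(−1/2) exp(−(μ−x̄)²/(2σ_n²)), and let φ(μ) = C·exp(−(μ−γ)²/(2σ_φ²)) with C > 0 chosen so that ∫_ℝ φ·π = 1. Then the information gain satisfies Δ = h(π) − h^φ(π) = (σ_n² − σ̃² − (μ̃ − x̄)²)/(2σ_n²) = (1/2)·σ_n²/(σ_n² + σ_φ²) − (1/2)·((γ − x̄)/σ_n)²·(σ_n²/(σ_n² + σ_φ²))². -/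
open MeasureTheory

open ProbabilityTheory in
/-- Integral of a quadratic against a Gaussian density. -/
lemma gauss_quad (m : ℝ) (v : NNReal) (hv : v ≠ 0) (a b c : ℝ) :
    ∫ x : ℝ, gaussianPDFReal m v x * (a + b * (x - c) ^ 2) = a + b * (v + (m - c) ^ 2) := by
  have h := integral_gaussianReal_eq_integral_smul (μ := m) hv
    (f := fun x : ℝ => a + b * (x - c) ^ 2)
  simp only [smul_eq_mul] at h
  rw [← h]
  have hL2 : MemLp (fun x : ℝ => x - m) 2 (gaussianReal m v) :=
    (memLp_id_gaussianReal' 2 (by simp)).sub (memLp_const m)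
  have hi2 : Integrable (fun x : ℝ => (x - m) ^ 2) (gaussianReal m v) := hL2.integrable_sq
  have hi1 : Integrable (fun x : ℝ => x - m) (gaussianReal m v) := hL2.integrable (by norm_num)
  have hid : Integrable (fun x : ℝ => x) (gaussianReal m v) :=
    (memLp_id_gaussianReal' (μ := m) (v := v) 1 (by simp)).integrable (by norm_num)
  have h2 : ∫ x : ℝ, (x - m) ^ 2 ∂(gaussianReal m v) = v := by
    have := variance_fun_id_gaussianReal (μ := m) (v := v)
    rw [variance_eq_integral (by fun_prop)] at this
    simpa [integral_id_gaussianReal] using this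
  have h1 : ∫ x : ℝ, (x - m) ∂(gaussianReal m v) = 0 := by
    rw [integral_sub hid (integrable_const _)]
    simp [integral_id_gaussianReal]
  have e : (fun x : ℝ => a + b * (x - c) ^ 2) = fun x =>
      (b * (x - m) ^ 2 + (2 * b * (m - c)) * (x - m)) + (a + b * (m - c) ^ 2) := by
    funext x; ring
  have hi3 : Integrable (fun x : ℝ => b * (x - m) ^ 2 + (2 * b * (m - c)) * (x - m))
      (gaussianReal m v) := (hi2.const_mul _).add (hi1.const_mul _)
  rw [e, integral_add hi3 (integrable_const _),
    integral_add (hi2.const_mul _) (hi1.const_mul _), integral_const_mul, integral_const_mul,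
    h1, h2]
  simp
  ring

/-- The information gain `Δ = h(π) − h^φ(π)` for the normal posterior `N(x̄, σn²)` and
a normalized Gaussian-kernel weight centered at `γ` with variance `σφ²` equals
`(σn² − σ̃² − (μ̃ − x̄)²)/(2σn²)`, i.e.
`(1/2)·σn²/(σn² + σφ²) − (1/2)·((γ−x̄)/σn)²·(σn²/(σn² + σφ²))²`. -/
theorem information_gain_closed_form
    (σn σφ xb γ : ℝ) (hσn : 0 < σn) (hσφ : 0 < σφ)
    (μt σt2 : ℝ)
    (hμt : μt = (γ * σn ^ 2 + xb * σφ ^ 2) / (σn ^ 2 + σφ ^ 2))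
    (hσt2 : σt2 = σn ^ 2 * σφ ^ 2 / (σn ^ 2 + σφ ^ 2))
    (f : ℝ → ℝ)
    (hf : ∀ μ : ℝ, f μ =
      (2 * Real.pi * σn ^ 2) ^ (-(1 / 2) : ℝ) * Real.exp (-(μ - xb) ^ 2 / (2 * σn ^ 2)))
    (C : ℝ) (hC : 0 < C)
    (w : ℝ → ℝ)
    (hw : ∀ μ : ℝ, w μ = C * Real.exp (-(μ - γ) ^ 2 / (2 * σφ ^ 2)))
    (hnorm : ∫ μ : ℝ, w μ * f μ = 1) :
    ((-∫ μ : ℝ, f μ * Real.log (f μ)) - (-∫ μ : ℝ, w μ * f μ * Real.log (f μ))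
        = (σn ^ 2 - σt2 - (μt - xb) ^ 2) / (2 * σn ^ 2))
    ∧ ((-∫ μ : ℝ, f μ * Real.log (f μ)) - (-∫ μ : ℝ, w μ * f μ * Real.log (f μ))
        = 1 / 2 * σn ^ 2 / (σn ^ 2 + σφ ^ 2)
          - 1 / 2 * ((γ - xb) / σn) ^ 2 * (σn ^ 2 / (σn ^ 2 + σφ ^ 2)) ^ 2) := by
  have hn2 : 0 < σn ^ 2 := by positivity
  have ht2 : 0 < σt2 := by rw [hσt2]; positivity
  set A : ℝ := (2 * Real.pi * σn ^ 2) ^ (-(1 / 2) : ℝ) with hA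
  have hApos : 0 < A := by positivity
  have hAeq : A = (Real.sqrt (2 * Real.pi * σn ^ 2))⁻¹ := by
    rw [hA, Real.rpow_neg (by positivity), Real.sqrt_eq_rpow]
  let vn : NNReal := ⟨σn ^ 2, hn2.le⟩
  let vt : NNReal := ⟨σt2, ht2.le⟩
  have hvn : vn ≠ 0 := fun h => hn2.ne' (congrArg NNReal.toReal h)
  have hvt : vt ≠ 0 := fun h => ht2.ne' (congrArg NNReal.toReal h)
  have hfg : ∀ x, f x = ProbabilityTheory.gaussianPDFReal xb vn x := by
    intro x
    rw [hf, hAeq, ProbabilityTheory.gaussianPDFReal]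
    rfl
  have hlog : ∀ x, Real.log (f x) = Real.log A + (-(1 / (2 * σn ^ 2))) * (x - xb) ^ 2 := by
    intro x
    rw [hf, Real.log_mul hApos.ne' (Real.exp_pos _).ne', Real.log_exp]
    ring
  obtain ⟨K, hK⟩ : ∃ K : ℝ, ∀ x, w x * f x
      = K * ProbabilityTheory.gaussianPDFReal μt vt x := by
    refine ⟨C * A * Real.exp (-(γ - xb) ^ 2 / (2 * (σn ^ 2 + σφ ^ 2)))
      * Real.sqrt (2 * Real.pi * σt2), fun x => ?_⟩
    have hs : Real.sqrt (2 * Real.pi * σt2) ≠ 0 := by positivity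
    have hex : Real.exp (-(x - γ) ^ 2 / (2 * σφ ^ 2)) * Real.exp (-(x - xb) ^ 2 / (2 * σn ^ 2))
        = Real.exp (-(γ - xb) ^ 2 / (2 * (σn ^ 2 + σφ ^ 2)))
          * Real.exp (-(x - μt) ^ 2 / (2 * σt2)) := by
      rw [← Real.exp_add, ← Real.exp_add]
      congr 1
      rw [hμt, hσt2]
      field_simp
      ring
    have hg : ProbabilityTheory.gaussianPDFReal μt vt x
        = (Real.sqrt (2 * Real.pi * σt2))⁻¹ * Real.exp (-(x - μt) ^ 2 / (2 * σt2)) := rfl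
    rw [hw, hf, hg]
    calc _ = C * A * (Real.exp (-(x - γ) ^ 2 / (2 * σφ ^ 2))
          * Real.exp (-(x - xb) ^ 2 / (2 * σn ^ 2))) := by ring
      _ = _ := by
        rw [hex]
        field_simp
  have hK1 : K = 1 := by
    simp only [hK] at hnorm
    rwa [integral_const_mul, ProbabilityTheory.integral_gaussianPDFReal_eq_one _ hvt,
      mul_one] at hnorm
  have I1 : ∫ μ : ℝ, f μ * Real.log (f μ)
      = Real.log A + (-(1 / (2 * σn ^ 2))) * (σn ^ 2 + (xb - xb) ^ 2) := by
    simp only [hlog]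
    simp only [hfg]
    exact gauss_quad xb vn hvn _ _ _
  have I2 : ∫ μ : ℝ, w μ * f μ * Real.log (f μ)
      = Real.log A + (-(1 / (2 * σn ^ 2))) * (σt2 + (μt - xb) ^ 2) := by
    simp only [hlog]
    simp only [hK, hK1, one_mul]
    exact gauss_quad μt vt hvt _ _ _
  have main : (-∫ μ : ℝ, f μ * Real.log (f μ)) - (-∫ μ : ℝ, w μ * f μ * Real.log (f μ))
        = (σn ^ 2 - σt2 - (μt - xb) ^ 2) / (2 * σn ^ 2) := by
    rw [I1, I2]
    field_simp
    ring
  refine ⟨main, main.trans ?_⟩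
  rw [hμt, hσt2]
  field_simp
  ring
end

section
/- Let q ≥ 1, let Ω_φ and Ω_n be symmetric positive-definite real q×q matrices with Σ_n = Ω_n⁻¹, and let γ, x̄ ∈ ℝ^q. Define Ω̃ = Ω_φ + Ω_n, Σ̃ = Ω̃⁻¹, μ̃ = Σ̃·(Ω_φ·γ + Ω_n·x̄), the posterior density π(μ) = (2π)^(−q/2)·det(Σ_n)^(−1/2)·exp(−(1/2)(x̄−μ)ᵀ Ω_n (x̄−μ)), and a weight φ(μ) = C·exp(−(1/2)(μ−γ)ᵀ Ω_φ (μ−γ)) with C > 0 such that ∫_{ℝ^q} φ·π = 1. Then the weighted Shannon entropy satisfies h^φ(π) = −∫_{ℝ^q} φ(μ)π(μ) log π(μ) dμ = (q/2)·log(2π) + (1/2)·log det(Σ_n) + (1/2)·tr(Ω_n·Σ̃) + (1/2)·(μ̃ − x̄)ᵀ Ω_n (μ̃ − x̄). -/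
open MeasureTheory Matrix

/-- moments of the standard Gaussian -/
lemma aux_mom (n : ℕ) : Integrable (fun x : ℝ => ProbabilityTheory.gaussianPDFReal 0 1 x * x ^ n) := by
  have h := (integrable_rpow_mul_exp_neg_mul_sq (b := 1/2) (by norm_num) (s := n)
    (by have : (0:ℝ) ≤ n := Nat.cast_nonneg n
        linarith)).const_mul ((√(2 * Real.pi * (1:NNReal)))⁻¹)
  refine h.congr (Filter.Eventually.of_forall fun x => ?_)
  simp only [ProbabilityTheory.gaussianPDFReal_def, Real.rpow_natCast]
  rw [show -(1/2) * x^2 = -(x-0)^2/(2 * ((1:NNReal):ℝ)) by push_cast; ring]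
  ring

lemma aux_m0 : ∫ x : ℝ, ProbabilityTheory.gaussianPDFReal 0 1 x * x ^ 0 = 1 := by
  simpa using ProbabilityTheory.integral_gaussianPDFReal_eq_one 0 (one_ne_zero)

lemma aux_m1 : ∫ x : ℝ, ProbabilityTheory.gaussianPDFReal 0 1 x * x ^ 1 = 0 := by
  have h := ProbabilityTheory.integral_id_gaussianReal (μ := 0) (v := 1)
  rw [ProbabilityTheory.integral_gaussianReal_eq_integral_smul one_ne_zero] at h
  simpa using h

lemma aux_m2 : ∫ x : ℝ, ProbabilityTheory.gaussianPDFReal 0 1 x * x ^ 2 = 1 := by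
  have h := ProbabilityTheory.variance_fun_id_gaussianReal (μ := 0) (v := 1)
  rw [ProbabilityTheory.variance_eq_integral measurable_id'.aemeasurable,
    ProbabilityTheory.integral_id_gaussianReal,
    ProbabilityTheory.integral_gaussianReal_eq_integral_smul one_ne_zero] at h
  simpa using h

/-- product Gaussian weight -/
noncomputable def auxP {q : ℕ} (z : Fin q → ℝ) : ℝ :=
  ∏ i, ProbabilityTheory.gaussianPDFReal 0 1 (z i)

lemma auxP_eq {q : ℕ} (z : Fin q → ℝ) :
    Real.exp (-(1/2) * (z ⬝ᵥ z)) = (√(2 * Real.pi)) ^ q * auxP z := by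
  have h0 : √(2 * Real.pi) ≠ 0 := by positivity
  simp only [auxP, ProbabilityTheory.gaussianPDFReal_def, Finset.prod_mul_distrib,
    Finset.prod_const, ← Real.exp_sum, Finset.card_univ, Fintype.card_fin, NNReal.coe_one, mul_one]
  rw [← mul_assoc, ← mul_pow, mul_inv_cancel₀ h0, one_pow, one_mul]
  congr 1
  simp only [dotProduct, Finset.mul_sum]
  refine Finset.sum_congr rfl fun i _ => ?_
  ring

lemma auxP_cont {q : ℕ} : Continuous (auxP (q := q)) := by
  unfold auxP
  simp only [ProbabilityTheory.gaussianPDFReal_def]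
  fun_prop

lemma aux_nd_int {q : ℕ} (e : Fin q → ℕ) :
    Integrable (fun z : Fin q → ℝ => auxP z * ∏ k, z k ^ e k) := by
  have := Integrable.fintype_prod (μ := fun _ : Fin q => (volume : Measure ℝ))
    (f := fun k x => ProbabilityTheory.gaussianPDFReal 0 1 x * x ^ e k) (fun k => aux_mom (e k))
  simp only [Finset.prod_mul_distrib] at this
  exact this

lemma aux_nd_val {q : ℕ} (e : Fin q → ℕ) :
    ∫ z : Fin q → ℝ, auxP z * ∏ k, z k ^ e k =
      ∏ k, ∫ x : ℝ, ProbabilityTheory.gaussianPDFReal 0 1 x * x ^ e k := by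
  have := integral_fintype_prod_volume_eq_prod
    (f := fun (k : Fin q) (x : ℝ) => ProbabilityTheory.gaussianPDFReal 0 1 x * x ^ e k)
  rw [← this]
  simp only [Finset.prod_mul_distrib, auxP]

lemma aux_P {q : ℕ} : Integrable (auxP (q := q)) ∧ ∫ z : Fin q → ℝ, auxP z = 1 := by
  have h1 := aux_nd_int (q := q) 0
  have h2 := aux_nd_val (q := q) 0
  simp only [Pi.zero_apply, aux_m0] at h2
  simp at h1 h2
  exact ⟨h1, h2⟩

lemma aux_P1 {q : ℕ} (i : Fin q) : Integrable (fun z : Fin q → ℝ => auxP z * z i) ∧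
    ∫ z : Fin q → ℝ, auxP z * z i = 0 := by
  have h1 := aux_nd_int (q := q) (Pi.single i 1)
  have h2 := aux_nd_val (q := q) (Pi.single i 1)
  have e : ∀ z : Fin q → ℝ, ∏ k, z k ^ (Pi.single i 1 : Fin q → ℕ) k = z i := by
    intro z
    rw [Finset.prod_eq_single i]
    · simp
    · intro b _ hb
      simp [hb]
    · simp
  simp only [e] at h1 h2
  refine ⟨h1, h2.trans (Finset.prod_eq_zero (Finset.mem_univ i) ?_)⟩
  rw [Pi.single_eq_same]
  exact aux_m1

lemma aux_P2 {q : ℕ} (i j : Fin q) : Integrable (fun z : Fin q → ℝ => auxP z * (z i * z j)) ∧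
    ∫ z : Fin q → ℝ, auxP z * (z i * z j) = if i = j then 1 else 0 := by
  have h1 := aux_nd_int (q := q) (Pi.single i 1 + Pi.single j 1)
  have h2 := aux_nd_val (q := q) (Pi.single i 1 + Pi.single j 1)
  have e0 : ∀ (i : Fin q) (z : Fin q → ℝ), ∏ k, z k ^ (Pi.single i 1 : Fin q → ℕ) k = z i := by
    intro i z
    rw [Finset.prod_eq_single i]
    · simp
    · intro b _ hb
      simp [hb]
    · simp
  have e : ∀ z : Fin q → ℝ,
      ∏ k, z k ^ (Pi.single i 1 + Pi.single j 1 : Fin q → ℕ) k = z i * z j := by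
    intro z
    simp only [Pi.add_apply, pow_add, Finset.prod_mul_distrib, e0]
  simp only [e] at h1 h2
  refine ⟨h1, h2.trans ?_⟩
  split_ifs with hij
  · subst hij
    refine Finset.prod_eq_one fun k _ => ?_
    by_cases hk : k = i
    · subst hk
      simp only [Pi.add_apply, Pi.single_eq_same]
      exact aux_m2
    · simp only [Pi.add_apply, Pi.single_eq_of_ne hk]
      exact aux_m0
  · refine Finset.prod_eq_zero (Finset.mem_univ i) ?_
    simp only [Pi.add_apply, Pi.single_eq_same, Pi.single_eq_of_ne hij]
    exact aux_m1

lemma aux_quad {q : ℕ} (a : ℝ) (b : Fin q → ℝ) (M : Matrix (Fin q) (Fin q) ℝ) :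
    ∫ z : Fin q → ℝ, auxP z * (a + b ⬝ᵥ z + z ⬝ᵥ M *ᵥ z) = a + M.trace := by
  have e : ∀ z : Fin q → ℝ, auxP z * (a + b ⬝ᵥ z + z ⬝ᵥ M *ᵥ z) =
      a * auxP z + ∑ i, b i * (auxP z * z i) + ∑ i, ∑ j, M i j * (auxP z * (z i * z j)) := by
    intro z
    simp only [dotProduct, mulVec, mul_add, Finset.mul_sum]
    congr 1
    · congr 1
      · ring
      · exact Finset.sum_congr rfl fun i _ => by ring
    · exact Finset.sum_congr rfl fun i _ => Finset.sum_congr rfl fun j _ => by ring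
  simp only [e]
  have i0 : Integrable (fun z : Fin q → ℝ => a * auxP z) := aux_P.1.const_mul a
  have i1 : ∀ i ∈ Finset.univ, Integrable (fun z : Fin q → ℝ => b i * (auxP z * z i)) :=
    fun i _ => (aux_P1 i).1.const_mul _
  have i2 : ∀ i, ∀ j ∈ Finset.univ,
      Integrable (fun z : Fin q → ℝ => M i j * (auxP z * (z i * z j))) :=
    fun i j _ => (aux_P2 i j).1.const_mul _
  have i3 : ∀ i ∈ Finset.univ,
      Integrable (fun z : Fin q → ℝ => ∑ j, M i j * (auxP z * (z i * z j))) :=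
    fun i _ => integrable_finsetSum _ (i2 i)
  have i4 : Integrable (fun z : Fin q → ℝ => a * auxP z + ∑ i, b i * (auxP z * z i)) :=
    i0.add (integrable_finsetSum _ i1)
  rw [integral_add i4 (integrable_finsetSum _ i3),
    integral_add i0 (integrable_finsetSum _ i1), integral_finsetSum _ i1, integral_finsetSum _ i3,
    Finset.sum_congr rfl (fun i _ => integral_finsetSum _ (i2 i))]
  simp only [integral_const_mul, aux_P.2, (aux_P1 _).2, (aux_P2 _ _).2]
  simp [Matrix.trace]

lemma aux_cov {q : ℕ} (B : Matrix (Fin q) (Fin q) ℝ) (hB : B.det ≠ 0) (m : Fin q → ℝ)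
    (F : (Fin q → ℝ) → ℝ) (hF : Continuous F) :
    ∫ x : Fin q → ℝ, F (B *ᵥ (x - m)) = |B.det⁻¹| * ∫ z, F z := by
  rw [integral_sub_right_eq_self (fun x => F (B *ᵥ x)) m]
  have h := Real.map_matrix_volume_pi_eq_smul_volume_pi hB
  have h2 : ∫ z, F z ∂(Measure.map (toLin' B) volume) = ∫ x, F (B *ᵥ x) := by
    rw [integral_map]
    · simp
    · exact (LinearMap.continuous_of_finiteDimensional _).aemeasurable
    · exact hF.aestronglyMeasurable
  rw [← h2, h, integral_smul_measure, ENNReal.toReal_ofReal (abs_nonneg _), smul_eq_mul]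

lemma aux_factor {q : ℕ} (S : Matrix (Fin q) (Fin q) ℝ) (hS : S.PosDef) :
    ∃ B : Matrix (Fin q) (Fin q) ℝ, B.det ≠ 0 ∧ S = Bᵀ * B := by
  open scoped MatrixOrder in
  obtain ⟨B, hB⟩ := CStarAlgebra.nonneg_iff_eq_star_mul_self.mp hS.posSemidef.nonneg
  have hB' : S = Bᵀ * B := by
    rw [hB, star_eq_conjTranspose, conjTranspose_eq_transpose_of_trivial]
  refine ⟨B, fun h => ?_, hB'⟩
  have := hS.det_pos
  rw [hB', det_mul, h] at this
  simp at this

lemma aux_symm {q : ℕ} (S : Matrix (Fin q) (Fin q) ℝ) (hS : S.PosDef) (u v : Fin q → ℝ) :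
    u ⬝ᵥ S *ᵥ v = v ⬝ᵥ S *ᵥ u := by
  have h : Sᵀ = S := by
    rw [← conjTranspose_eq_transpose_of_trivial]
    exact hS.isHermitian
  rw [dotProduct_mulVec, ← mulVec_transpose, h, dotProduct_comm]

/-- Value of the multivariate weighted Shannon entropy
`h^φ(π) = −∫ φ·π·log π = (q/2)log(2π) + (1/2)log det Σn + (1/2)tr(Ωn·Σ̃)
 + (1/2)(μ̃−x̄)ᵀ Ωn (μ̃−x̄)`. -/
theorem multivariate_weighted_entropy_value
    (q : ℕ) (hq : 1 ≤ q)
    (Ωφ Ωn : Matrix (Fin q) (Fin q) ℝ)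
    (hΩφ : Ωφ.PosDef) (hΩn : Ωn.PosDef)
    (Sn : Matrix (Fin q) (Fin q) ℝ) (hSn : Sn = Ωn⁻¹)
    (γ xb : Fin q → ℝ)
    (Ωt : Matrix (Fin q) (Fin q) ℝ) (hΩt : Ωt = Ωφ + Ωn)
    (St : Matrix (Fin q) (Fin q) ℝ) (hSt : St = Ωt⁻¹)
    (μt : Fin q → ℝ) (hμt : μt = St.mulVec (Ωφ.mulVec γ + Ωn.mulVec xb))
    (f : (Fin q → ℝ) → ℝ)
    (hf : ∀ μ : Fin q → ℝ, f μ =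
      (2 * Real.pi) ^ (-(q : ℝ) / 2) * Sn.det ^ (-(1 / 2) : ℝ)
        * Real.exp (-(1 / 2) * ((xb - μ) ⬝ᵥ Ωn.mulVec (xb - μ))))
    (C : ℝ) (hC : 0 < C)
    (w : (Fin q → ℝ) → ℝ)
    (hw : ∀ μ : Fin q → ℝ, w μ =
      C * Real.exp (-(1 / 2) * ((μ - γ) ⬝ᵥ Ωφ.mulVec (μ - γ))))
    (hnorm : ∫ μ : Fin q → ℝ, w μ * f μ = 1) :
    -∫ μ : Fin q → ℝ, w μ * f μ * Real.log (f μ)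
      = (q : ℝ) / 2 * Real.log (2 * Real.pi) + 1 / 2 * Real.log Sn.det
        + 1 / 2 * (Ωn * St).trace + 1 / 2 * ((μt - xb) ⬝ᵥ Ωn.mulVec (μt - xb)) := by
  subst hSn hΩt hSt
  have hP : (Ωφ + Ωn).PosDef := hΩφ.add hΩn
  obtain ⟨B, hB, hBt⟩ := aux_factor _ hP
  have hBu : IsUnit B.det := isUnit_iff_ne_zero.mpr hB
  have hPu : IsUnit (Ωφ + Ωn).det := isUnit_iff_ne_zero.mpr hP.det_pos.ne'
  -- stationarity of the combined mean
  have hst : (Ωφ + Ωn) *ᵥ μt = Ωφ *ᵥ γ + Ωn *ᵥ xb := by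
    rw [hμt, mulVec_mulVec, mul_nonsing_inv _ hPu, one_mulVec]
  have hdet : 0 < (Ωn⁻¹).det := hΩn.inv.det_pos
  set c0 : ℝ := (2 * Real.pi) ^ (-(q : ℝ) / 2) * (Ωn⁻¹).det ^ (-(1 / 2) : ℝ) with hc0
  have hc0pos : 0 < c0 := by positivity
  have hlogc0 : Real.log c0 =
      -((q : ℝ) / 2 * Real.log (2 * Real.pi) + 1 / 2 * Real.log (Ωn⁻¹).det) := by
    rw [hc0, Real.log_mul (by positivity) (by positivity), Real.log_rpow (by positivity),
      Real.log_rpow hdet]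
    ring
  have hquad : ∀ x, (x - γ) ⬝ᵥ Ωφ *ᵥ (x - γ) + (xb - x) ⬝ᵥ Ωn *ᵥ (xb - x) =
      (x - μt) ⬝ᵥ (Ωφ + Ωn) *ᵥ (x - μt) +
      (γ ⬝ᵥ Ωφ *ᵥ γ + xb ⬝ᵥ Ωn *ᵥ xb - μt ⬝ᵥ (Ωφ + Ωn) *ᵥ μt) := by
    intro x
    have s1 := aux_symm _ hΩφ x γ
    have s2 := aux_symm _ hΩn x xb
    have s3 := aux_symm _ hP x μt
    have s4 : x ⬝ᵥ (Ωφ + Ωn) *ᵥ μt = x ⬝ᵥ Ωφ *ᵥ γ + x ⬝ᵥ Ωn *ᵥ xb := by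
      rw [hst, dotProduct_add]
    have s5 : x ⬝ᵥ (Ωφ + Ωn) *ᵥ x = x ⬝ᵥ Ωφ *ᵥ x + x ⬝ᵥ Ωn *ᵥ x := by
      rw [add_mulVec, dotProduct_add]
    simp only [mulVec_sub, dotProduct_sub, sub_dotProduct]
    linarith
  set k : ℝ := γ ⬝ᵥ Ωφ *ᵥ γ + xb ⬝ᵥ Ωn *ᵥ xb - μt ⬝ᵥ (Ωφ + Ωn) *ᵥ μt with hk
  have hBB : ∀ u, u ⬝ᵥ (Ωφ + Ωn) *ᵥ u = (B *ᵥ u) ⬝ᵥ (B *ᵥ u) := by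
    intro u
    rw [hBt, ← mulVec_mulVec, dotProduct_mulVec, vecMul_transpose]
  set K : ℝ := C * c0 * Real.exp (-(1/2) * k) * (√(2 * Real.pi)) ^ q with hK
  have hwf : ∀ x, w x * f x = K * auxP (B *ᵥ (x - μt)) := by
    intro x
    have h := auxP_eq (B *ᵥ (x - μt))
    rw [hw, hf, hK, mul_assoc _ (√(2 * Real.pi) ^ q), ← h, ← hBB]
    have h2 := hquad x
    calc _ = C * c0 * Real.exp (-(1/2) * ((x - γ) ⬝ᵥ Ωφ *ᵥ (x - γ)
            + (xb - x) ⬝ᵥ Ωn *ᵥ (xb - x))) := by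
          rw [mul_add, Real.exp_add]; ring
      _ = _ := by
          rw [h2, mul_add, Real.exp_add]; ring
  have hKd : K * |B.det⁻¹| = 1 := by
    simp only [hwf, integral_const_mul] at hnorm
    rw [aux_cov B hB μt auxP auxP_cont, aux_P.2, mul_one] at hnorm
    exact hnorm
  set d : Fin q → ℝ := μt - xb with hd
  have hlog : ∀ x, Real.log (f x) = (Real.log c0 - 1/2 * (d ⬝ᵥ Ωn *ᵥ d))
      + (-(Bᵀ⁻¹ *ᵥ (Ωn *ᵥ d))) ⬝ᵥ (B *ᵥ (x - μt))
      + (B *ᵥ (x - μt)) ⬝ᵥ ((-(1/2) : ℝ) • (Bᵀ⁻¹ * Ωn * B⁻¹)) *ᵥ (B *ᵥ (x - μt)) := by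
    intro x
    have hx : xb - x = -((x - μt) + d) := by rw [hd]; abel
    have hinv : B⁻¹ *ᵥ (B *ᵥ (x - μt)) = x - μt := by
      rw [mulVec_mulVec, nonsing_inv_mul _ hBu, one_mulVec]
    have hadj : ∀ v, (Bᵀ⁻¹ *ᵥ v) ⬝ᵥ (B *ᵥ (x - μt)) = v ⬝ᵥ (x - μt) := by
      intro v
      rw [← transpose_nonsing_inv, mulVec_transpose, ← dotProduct_mulVec, hinv]
    have s := aux_symm _ hΩn (x - μt) d
    rw [hf, Real.log_mul hc0pos.ne' (Real.exp_pos _).ne', Real.log_exp, hx]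
    rw [neg_dotProduct (Bᵀ⁻¹ *ᵥ (Ωn *ᵥ d)), hadj, smul_mulVec, dotProduct_smul, ← mulVec_mulVec, hinv,
      ← mulVec_mulVec, dotProduct_comm (B *ᵥ (x - μt)), hadj, dotProduct_comm (Ωn *ᵥ d),
      dotProduct_comm (Ωn *ᵥ (x - μt))]
    simp only [mulVec_neg, mulVec_add, neg_dotProduct, dotProduct_neg, dotProduct_add,
      add_dotProduct, smul_eq_mul]
    linarith
  have hmain : ∫ x, w x * f x * Real.log (f x) =
      (Real.log c0 - 1/2 * (d ⬝ᵥ Ωn *ᵥ d)) + ((-(1/2) : ℝ) • (Bᵀ⁻¹ * Ωn * B⁻¹)).trace := by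
    simp only [hwf, hlog, mul_assoc K, integral_const_mul]
    have hc : Continuous (auxP (q := q)) := auxP_cont
    rw [aux_cov B hB μt (fun z => auxP z * ((Real.log c0 - 1/2 * (d ⬝ᵥ Ωn *ᵥ d))
      + (-(Bᵀ⁻¹ *ᵥ (Ωn *ᵥ d))) ⬝ᵥ z
      + z ⬝ᵥ ((-(1/2) : ℝ) • (Bᵀ⁻¹ * Ωn * B⁻¹)) *ᵥ z)) (by fun_prop), aux_quad, ← mul_assoc, hKd,
      one_mul]
  have htr : (Bᵀ⁻¹ * Ωn * B⁻¹).trace = (Ωn * (Ωφ + Ωn)⁻¹).trace := by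
    rw [hBt, Matrix.mul_inv_rev, mul_assoc, trace_mul_comm, mul_assoc]
  rw [hmain, trace_smul, htr, hlogc0, smul_eq_mul]
  ring
end

section
/- Let q ≥ 1, let Ω_φ and Ω_n be symmetric positive-definite real q×q matrices with Σ_n = Ω_n⁻¹, and let γ, x̄ ∈ ℝ^q. Let π be the density of MVN(x̄, Σ_n) and φ(μ) = C·exp(−(1/2)(μ−γ)ᵀ Ω_φ (μ−γ)) with C > 0 such that ∫_{ℝ^q} φ·π = 1. Then the information gain satisfies Δ = h(π) − h^φ(π) = q/2 − (1/2)·tr[Ω_n·(Ω_n + Ω_φ)⁻¹] − (1/2)·(γ − x̄)ᵀ Ω_φ (Ω_n + Ω_φ)⁻¹ Ω_n (Ω_n + Ω_φ)⁻¹ Ω_φ (γ − x̄). -/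
open MeasureTheory Matrix

lemma oneD : (Integrable fun t : ℝ => Real.exp (-(1/2) * t^2)) ∧ (Integrable fun t : ℝ => t * Real.exp (-(1/2) * t^2)) ∧
   (Integrable fun t : ℝ => t * t * Real.exp (-(1/2) * t^2)) ∧
   (∫ t : ℝ, Real.exp (-(1/2) * t^2)) = √(2 * Real.pi) ∧ (∫ t : ℝ, t * Real.exp (-(1/2) * t^2)) = 0 ∧
   (∫ t : ℝ, t * t * Real.exp (-(1/2) * t^2)) = √(2 * Real.pi) := by
  have h0 : (0:ℝ) < 1/2 := by norm_num
  have hs : √(2 * Real.pi) ≠ 0 := by positivity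
  refine ⟨integrable_exp_neg_mul_sq h0, integrable_mul_exp_neg_mul_sq h0, ?_, ?_, ?_, ?_⟩
  · have := integrable_rpow_mul_exp_neg_mul_sq h0 (by norm_num : (-1:ℝ) < 2)
    simpa [← pow_two] using this
  · rw [integral_gaussian]; congr 1; field_simp
  · have := ProbabilityTheory.integral_gaussianReal_eq_integral_smul (μ := 0) (v := 1) (f := fun x : ℝ => x) one_ne_zero
    rw [ProbabilityTheory.integral_id_gaussianReal] at this
    simp only [ProbabilityTheory.gaussianPDFReal, smul_eq_mul, mul_assoc, integral_const_mul] at this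
    have h4 := (mul_eq_zero.1 this.symm).resolve_left (by simpa using (by positivity : √Real.pi ≠ 0))
    rw [← h4]
    congr 1; ext t; rw [mul_comm]; congr 2; push_cast; ring
  · have := ProbabilityTheory.integral_gaussianReal_eq_integral_smul (μ := 0) (v := 1) (f := fun x : ℝ => x^2) one_ne_zero
    have h2 : ∫ x, x^2 ∂(ProbabilityTheory.gaussianReal 0 1) = 1 := by
      have := ProbabilityTheory.variance_fun_id_gaussianReal (μ := 0) (v := 1)
      rw [ProbabilityTheory.variance_eq_integral (by fun_prop)] at this
      simpa using this
    rw [h2] at this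
    simp only [ProbabilityTheory.gaussianPDFReal, smul_eq_mul, mul_assoc, integral_const_mul] at this
    have h3 : ∫ t : ℝ, t * t * Real.exp (-(1/2) * t^2) = ∫ (a : ℝ), Real.exp (-(a - 0) ^ 2 / (2 * ((1:NNReal):ℝ))) * a ^ 2 := by
      congr 1; ext t; rw [mul_comm, pow_two t]; congr 2; push_cast; ring
    rw [h3]
    simp only [NNReal.coe_one, mul_one] at this ⊢
    rw [eq_comm, inv_mul_eq_one₀ hs] at this
    exact this.symm

section
variable {q : ℕ}

lemma exp_prod (y : Fin q → ℝ) : Real.exp (-(1/2) * (y ⬝ᵥ y)) = ∏ k, Real.exp (-(1/2) * (y k)^2) := by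
  rw [← Real.exp_sum, ← Finset.mul_sum]; simp [dotProduct, pow_two]

lemma m0 : Integrable (fun y : Fin q → ℝ => Real.exp (-(1/2) * (y ⬝ᵥ y))) ∧
   ∫ y : Fin q → ℝ, Real.exp (-(1/2) * (y ⬝ᵥ y)) = √(2 * Real.pi) ^ q := by
  simp_rw [exp_prod]
  refine ⟨Integrable.fintype_prod (f := fun _ t => Real.exp (-(1/2) * t^2)) fun _ => oneD.1, ?_⟩
  rw [integral_fintype_prod_volume_eq_pow (fun t : ℝ => Real.exp (-(1/2) * t^2)), oneD.2.2.2.1]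
  simp

lemma m1 (i : Fin q) : Integrable (fun y : Fin q → ℝ => y i * Real.exp (-(1/2) * (y ⬝ᵥ y))) ∧
   ∫ y : Fin q → ℝ, y i * Real.exp (-(1/2) * (y ⬝ᵥ y)) = 0 := by
  have key : (fun y : Fin q → ℝ => y i * Real.exp (-(1/2) * (y ⬝ᵥ y))) =
      fun y => ∏ k, (fun (k : Fin q) (t : ℝ) => (if k = i then t else 1) * Real.exp (-(1/2) * t^2)) k (y k) := by
    ext y; rw [exp_prod, Finset.prod_mul_distrib]; simp
  rw [key]
  refine ⟨Integrable.fintype_prod (f := (fun (k : Fin q) (t : ℝ) => (if k = i then t else 1) * Real.exp (-(1/2) * t^2))) fun k => ?_, ?_⟩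
  · by_cases h : k = i
    · simpa [h] using oneD.2.1
    · simpa [h] using oneD.1
  · rw [integral_fintype_prod_volume_eq_prod (fun (k : Fin q) (t : ℝ) => (if k = i then t else 1) * Real.exp (-(1/2) * t^2))]
    apply Finset.prod_eq_zero (Finset.mem_univ i)
    simpa using oneD.2.2.2.2.1

lemma m2 (i j : Fin q) : Integrable (fun y : Fin q → ℝ => y i * y j * Real.exp (-(1/2) * (y ⬝ᵥ y))) ∧
   ∫ y : Fin q → ℝ, y i * y j * Real.exp (-(1/2) * (y ⬝ᵥ y)) = if i = j then √(2 * Real.pi) ^ q else 0 := by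
  have key : (fun y : Fin q → ℝ => y i * y j * Real.exp (-(1/2) * (y ⬝ᵥ y))) =
      fun y => ∏ k, (fun (k : Fin q) (t : ℝ) => (if k = i then t else 1) * (if k = j then t else 1) * Real.exp (-(1/2) * t^2)) k (y k) := by
    ext y; rw [exp_prod, Finset.prod_mul_distrib, Finset.prod_mul_distrib]; simp
  rw [key]
  refine ⟨Integrable.fintype_prod (f := (fun (k : Fin q) (t : ℝ) => (if k = i then t else 1) * (if k = j then t else 1) * Real.exp (-(1/2) * t^2))) fun k => ?_, ?_⟩
  · by_cases h : k = i <;> by_cases h' : k = j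
    · simpa only [if_pos h, if_pos h'] using oneD.2.2.1
    · simpa only [if_pos h, if_neg h', mul_one] using oneD.2.1
    · simpa only [if_neg h, if_pos h', one_mul] using oneD.2.1
    · simpa only [if_neg h, if_neg h', one_mul] using oneD.1
  · rw [integral_fintype_prod_volume_eq_prod (fun (k : Fin q) (t : ℝ) => (if k = i then t else 1) * (if k = j then t else 1) * Real.exp (-(1/2) * t^2))]
    by_cases hij : i = j
    · subst hij
      rw [if_pos rfl]
      trans ∏ k : Fin q, √(2 * Real.pi)
      · apply Finset.prod_congr rfl
        intro k _
        by_cases h : k = i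
        · simpa only [if_pos h] using oneD.2.2.2.2.2
        · simpa only [if_neg h, one_mul] using oneD.2.2.2.1
      · simp
    · rw [if_neg hij]
      apply Finset.prod_eq_zero (Finset.mem_univ i)
      simpa [hij] using oneD.2.2.2.2.1

lemma std (c : ℝ) (v : Fin q → ℝ) (M : Matrix (Fin q) (Fin q) ℝ) :
   ∫ y : Fin q → ℝ, (c + v ⬝ᵥ y + y ⬝ᵥ M *ᵥ y) * Real.exp (-(1/2) * (y ⬝ᵥ y)) = √(2 * Real.pi) ^ q * (c + M.trace) := by
  have key : (fun y : Fin q → ℝ => (c + v ⬝ᵥ y + y ⬝ᵥ M *ᵥ y) * Real.exp (-(1/2) * (y ⬝ᵥ y))) =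
    fun y => c * Real.exp (-(1/2) * (y ⬝ᵥ y)) + ∑ i, v i * (y i * Real.exp (-(1/2) * (y ⬝ᵥ y)))
      + ∑ i, ∑ j, M i j * (y i * y j * Real.exp (-(1/2) * (y ⬝ᵥ y))) := by
    ext y
    generalize Real.exp (-(1/2) * (y ⬝ᵥ y)) = E
    simp only [add_mul, dotProduct, mulVec, Finset.sum_mul, Finset.mul_sum]
    congr 1
    · congr 1; exact Finset.sum_congr rfl fun i _ => by ring
    · exact Finset.sum_congr rfl fun i _ => Finset.sum_congr rfl fun j _ => by ring
  rw [key]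
  have i0 := (m0 (q := q)).1.const_mul c
  have i1 : ∀ i ∈ Finset.univ, Integrable fun y : Fin q → ℝ => v i * (y i * Real.exp (-(1/2) * (y ⬝ᵥ y))) :=
    fun i _ => (m1 i).1.const_mul _
  have i2' : ∀ i, ∀ j ∈ Finset.univ, Integrable fun y : Fin q → ℝ => M i j * (y i * y j * Real.exp (-(1/2) * (y ⬝ᵥ y))) :=
    fun i j _ => (m2 i j).1.const_mul _
  have i2 : ∀ i ∈ Finset.univ, Integrable fun y : Fin q → ℝ => ∑ j, M i j * (y i * y j * Real.exp (-(1/2) * (y ⬝ᵥ y))) :=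
    fun i _ => integrable_finsetSum _ (i2' i)
  have i01 : Integrable fun y : Fin q → ℝ => c * Real.exp (-(1/2) * (y ⬝ᵥ y)) +
      ∑ i, v i * (y i * Real.exp (-(1/2) * (y ⬝ᵥ y))) := i0.add (integrable_finsetSum _ i1)
  rw [integral_add i01 (integrable_finsetSum _ i2),
    integral_add i0 (integrable_finsetSum _ i1), integral_finsetSum _ i1, integral_finsetSum _ i2]
  simp_rw [fun i => integral_finsetSum _ (i2' i), integral_const_mul, m0.2, (m1 _).2, (m2 _ _).2]
  simp [trace, ← Finset.sum_mul]
  ring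

open scoped MatrixOrder in
lemma exists_sqrt {A : Matrix (Fin q) (Fin q) ℝ} (hA : A.PosDef) :
    ∃ B : Matrix (Fin q) (Fin q) ℝ, A = Bᵀ * B := by
  obtain ⟨B, hB⟩ := CStarAlgebra.nonneg_iff_eq_star_mul_self.1 hA.posSemidef.nonneg
  exact ⟨B, by simpa [star_eq_conjTranspose, conjTranspose_eq_transpose_of_trivial] using hB⟩

lemma gen {A : Matrix (Fin q) (Fin q) ℝ} (hA : A.PosDef) (c : ℝ) (v : Fin q → ℝ) (M : Matrix (Fin q) (Fin q) ℝ) :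
   ∫ y : Fin q → ℝ, (c + v ⬝ᵥ y + y ⬝ᵥ M *ᵥ y) * Real.exp (-(1/2) * (y ⬝ᵥ A *ᵥ y))
     = √(2 * Real.pi) ^ q * (√A.det)⁻¹ * (c + (M * A⁻¹).trace) := by
  obtain ⟨B, rfl⟩ := exists_sqrt hA
  have hd := hA.det_pos
  rw [det_mul, det_transpose] at hd
  have hB : B.det ≠ 0 := fun h => by simp [h] at hd
  have hBB : B⁻¹ * B = 1 := nonsing_inv_mul B (Ne.isUnit hB)
  have hmap := Real.map_matrix_volume_pi_eq_smul_volume_pi hB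
  have hs := std c (v ᵥ* B⁻¹) ((B⁻¹)ᵀ * M * B⁻¹)
  set g := fun y : Fin q → ℝ => (c + (v ᵥ* B⁻¹) ⬝ᵥ y + y ⬝ᵥ ((B⁻¹)ᵀ * M * B⁻¹) *ᵥ y) * Real.exp (-(1/2) * (y ⬝ᵥ y)) with hg
  have hgc : Continuous g := by
    simp only [hg]
    fun_prop
  have h1 : ∫ y : Fin q → ℝ, (c + v ⬝ᵥ y + y ⬝ᵥ M *ᵥ y) * Real.exp (-(1/2) * (y ⬝ᵥ (Bᵀ * B) *ᵥ y)) =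
     ∫ y, g (toLin' B y) := by
    congr 1; ext y
    have e1 : (v ᵥ* B⁻¹) ⬝ᵥ (B *ᵥ y) = v ⬝ᵥ y := by
      rw [dotProduct_mulVec, vecMul_vecMul, hBB, vecMul_one]
    have e2 : (B *ᵥ y) ⬝ᵥ ((B⁻¹)ᵀ * M * B⁻¹) *ᵥ (B *ᵥ y) = y ⬝ᵥ M *ᵥ y := by
      rw [mulVec_mulVec, Matrix.mul_assoc, hBB, Matrix.mul_one, ← mulVec_mulVec, dotProduct_mulVec, vecMul_transpose,
        mulVec_mulVec, hBB, one_mulVec]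
    have e3 : (B *ᵥ y) ⬝ᵥ (B *ᵥ y) = y ⬝ᵥ (Bᵀ * B) *ᵥ y := by
      rw [← mulVec_mulVec, dotProduct_mulVec y, vecMul_transpose]
    simp only [hg, toLin'_apply, e1, e2, e3]
  have hcont : Continuous (toLin' B) := LinearMap.continuous_of_finiteDimensional _
  rw [h1, ← integral_map hcont.aemeasurable hgc.aestronglyMeasurable, hmap, integral_smul_measure, hs,
    ENNReal.toReal_ofReal (abs_nonneg _), det_mul, det_transpose, Real.sqrt_mul_self_eq_abs, abs_inv, smul_eq_mul,
    Matrix.mul_inv_rev, ← transpose_nonsing_inv, Matrix.mul_assoc, trace_mul_comm, Matrix.mul_assoc]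
  ring

end

/-- General multivariate information gain:
`Δ = h(π) − h^φ(π) = q/2 − (1/2)tr[Ωn(Ωn+Ωφ)⁻¹]
  − (1/2)(γ−x̄)ᵀ Ωφ(Ωn+Ωφ)⁻¹ Ωn (Ωn+Ωφ)⁻¹ Ωφ (γ−x̄)`. -/
theorem multivariate_information_gain_general
    (q : ℕ) (hq : 1 ≤ q)
    (Ωφ Ωn : Matrix (Fin q) (Fin q) ℝ)
    (hΩφ : Ωφ.PosDef) (hΩn : Ωn.PosDef)
    (Sn : Matrix (Fin q) (Fin q) ℝ) (hSn : Sn = Ωn⁻¹)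
    (γ xb : Fin q → ℝ)
    (f : (Fin q → ℝ) → ℝ)
    (hf : ∀ μ : Fin q → ℝ, f μ =
      (2 * Real.pi) ^ (-(q : ℝ) / 2) * Sn.det ^ (-(1 / 2) : ℝ)
        * Real.exp (-(1 / 2) * ((xb - μ) ⬝ᵥ Ωn.mulVec (xb - μ))))
    (C : ℝ) (hC : 0 < C)
    (w : (Fin q → ℝ) → ℝ)
    (hw : ∀ μ : Fin q → ℝ, w μ =
      C * Real.exp (-(1 / 2) * ((μ - γ) ⬝ᵥ Ωφ.mulVec (μ - γ))))
    (hnorm : ∫ μ : Fin q → ℝ, w μ * f μ = 1) :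
    (-∫ μ : Fin q → ℝ, f μ * Real.log (f μ))
      - (-∫ μ : Fin q → ℝ, w μ * f μ * Real.log (f μ))
      = (q : ℝ) / 2 - 1 / 2 * (Ωn * (Ωn + Ωφ)⁻¹).trace
        - 1 / 2 * ((γ - xb) ⬝ᵥ
            (Ωφ * (Ωn + Ωφ)⁻¹ * Ωn * (Ωn + Ωφ)⁻¹ * Ωφ).mulVec (γ - xb)) := by
  have hdet := hΩn.det_pos
  set K := (2 * Real.pi) ^ (-(q : ℝ) / 2) * Sn.det ^ (-(1 / 2) : ℝ) with hK
  have hKv : K * (√(2 * Real.pi) ^ q * (√Ωn.det)⁻¹) = 1 := by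
    have a1 : (2 * Real.pi) ^ (-(q : ℝ) / 2) = (√(2 * Real.pi) ^ q)⁻¹ := by
      rw [neg_div, Real.rpow_neg (by positivity), Real.sqrt_eq_rpow, ← Real.rpow_natCast, ← Real.rpow_mul (by positivity)]
      congr 2; ring
    have a2 : Sn.det ^ (-(1 / 2) : ℝ) = √Ωn.det := by
      rw [hSn, det_nonsing_inv, Ring.inverse_eq_inv', Real.rpow_neg (by positivity), ← Real.sqrt_eq_rpow, Real.sqrt_inv, inv_inv]
    rw [hK, a1, a2]
    have : √Ωn.det ≠ 0 := by positivity
    have : √(2 * Real.pi) ≠ 0 := by positivity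
    field_simp
  have hK0 : 0 < K := by
    have : 0 < Sn.det := by rw [hSn]; exact hΩn.inv.det_pos
    positivity
  clear_value K
  have hlog : ∀ μ, Real.log (f μ) = Real.log K - 1/2 * ((xb - μ) ⬝ᵥ Ωn *ᵥ (xb - μ)) := by
    intro μ
    rw [hf, Real.log_mul hK0.ne' (Real.exp_pos _).ne', Real.log_exp]; ring
  have hA : (Ωn + Ωφ).PosDef := hΩn.add hΩφ
  have hAu : IsUnit (Ωn + Ωφ).det := hA.det_pos.ne'.isUnit
  have sn : Ωnᵀ = Ωn := by simpa [conjTranspose_eq_transpose_of_trivial] using hΩn.isHermitian.eq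
  have sp : Ωφᵀ = Ωφ := by simpa [conjTranspose_eq_transpose_of_trivial] using hΩφ.isHermitian.eq
  have swn : ∀ a b, a ⬝ᵥ Ωn *ᵥ b = b ⬝ᵥ Ωn *ᵥ a := fun a b => by
    rw [dotProduct_mulVec, ← mulVec_transpose, sn, dotProduct_comm]
  have swp : ∀ a b, a ⬝ᵥ Ωφ *ᵥ b = b ⬝ᵥ Ωφ *ᵥ a := fun a b => by
    rw [dotProduct_mulVec, ← mulVec_transpose, sp, dotProduct_comm]
  -- first integral
  have I1 : ∫ μ : Fin q → ℝ, f μ * Real.log (f μ) = Real.log K - q / 2 := by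
    rw [← integral_add_right_eq_self _ xb]
    have := gen hΩn (Real.log K) 0 (-(1/2 : ℝ) • Ωn)
    have e : ∀ y, f (y + xb) * Real.log (f (y + xb)) =
      K * ((Real.log K + 0 ⬝ᵥ y + y ⬝ᵥ (-(1/2 : ℝ) • Ωn) *ᵥ y) * Real.exp (-(1/2) * (y ⬝ᵥ Ωn *ᵥ y))) := by
      intro y
      have : xb - (y + xb) = -y := by abel
      rw [hlog, hf, this]
      simp only [mulVec_neg, neg_dotProduct_neg, zero_dotProduct, smul_mulVec, dotProduct_smul, smul_eq_mul]
      ring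
    simp_rw [e]
    rw [integral_const_mul, this, ← mul_assoc, hKv, smul_mul, mul_nonsing_inv _ hdet.ne'.isUnit, trace_smul, trace_one]
    simp; ring
  -- second
  set d := (Ωn + Ωφ)⁻¹ *ᵥ (Ωφ *ᵥ (γ - xb)) with hd
  have hAd : Ωn *ᵥ d + Ωφ *ᵥ d = Ωφ *ᵥ (γ - xb) := by
    rw [← add_mulVec, hd, mulVec_mulVec, mul_nonsing_inv _ hAu, one_mulVec]
  have hcross : ∀ y, y ⬝ᵥ Ωn *ᵥ d + y ⬝ᵥ Ωφ *ᵥ d = y ⬝ᵥ Ωφ *ᵥ (γ - xb) := fun y => by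
    rw [← dotProduct_add, hAd]
  set m := xb + d with hm
  obtain ⟨D, hD⟩ : ∃ D, ∀ y, w (y + m) * f (y + m) = D * Real.exp (-(1/2) * (y ⬝ᵥ (Ωn + Ωφ) *ᵥ y)) := by
    refine ⟨C * K * Real.exp (-(1/2) * (d ⬝ᵥ Ωn *ᵥ d + (d - (γ - xb)) ⬝ᵥ Ωφ *ᵥ (d - (γ - xb)))), fun y => ?_⟩
    have e1 : y + m - γ = y + (d - (γ - xb)) := by rw [hm]; abel
    have e2 : xb - (y + m) = -(y + d) := by rw [hm]; abel
    rw [hw, hf, e1, e2]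
    rw [mul_mul_mul_comm, ← Real.exp_add, mul_assoc (C * K), ← Real.exp_add]
    congr 2
    have h := hcross y
    generalize γ - xb = u at *
    simp only [mulVec_neg, neg_dotProduct_neg, mulVec_add, add_dotProduct, dotProduct_add, add_mulVec,
      mulVec_sub, sub_dotProduct, dotProduct_sub]
    rw [swn d y, swp d y, swp u y]
    linarith
  have hN : D * (√(2 * Real.pi) ^ q * (√(Ωn + Ωφ).det)⁻¹) = 1 := by
    rw [← integral_add_right_eq_self _ m] at hnorm
    simp_rw [hD] at hnorm
    have := gen hA 1 0 0
    simp only [zero_dotProduct, zero_mulVec, dotProduct_zero, add_zero, one_mul, Matrix.zero_mul, trace_zero, mul_one] at this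
    rw [integral_const_mul, this] at hnorm
    exact hnorm
  have I2 : ∫ μ : Fin q → ℝ, w μ * f μ * Real.log (f μ) =
      Real.log K - 1/2 * (d ⬝ᵥ Ωn *ᵥ d) - 1/2 * (Ωn * (Ωn + Ωφ)⁻¹).trace := by
    rw [← integral_add_right_eq_self _ m]
    have := gen hA (Real.log K - 1/2 * (d ⬝ᵥ Ωn *ᵥ d)) (-(Ωn *ᵥ d)) (-(1/2 : ℝ) • Ωn)
    have e : ∀ y, w (y + m) * f (y + m) * Real.log (f (y + m)) =
      D * ((Real.log K - 1/2 * (d ⬝ᵥ Ωn *ᵥ d) + (-(Ωn *ᵥ d)) ⬝ᵥ y + y ⬝ᵥ (-(1/2 : ℝ) • Ωn) *ᵥ y) * Real.exp (-(1/2) * (y ⬝ᵥ (Ωn + Ωφ) *ᵥ y))) := by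
      intro y
      have e2 : xb - (y + m) = -(y + d) := by rw [hm]; abel
      rw [hD, hlog, e2]
      simp only [mulVec_neg, neg_dotProduct_neg, mulVec_add, add_dotProduct, dotProduct_add, neg_dotProduct, dotProduct_neg,
        smul_mulVec, dotProduct_smul, smul_eq_mul]
      rw [swn d y, dotProduct_comm (Ωn *ᵥ d) y]
      ring
    simp_rw [e]
    rw [integral_const_mul, this, ← mul_assoc, hN, smul_mul, trace_smul, smul_eq_mul]
    ring
  have hq : (γ - xb) ⬝ᵥ (Ωφ * (Ωn + Ωφ)⁻¹ * Ωn * (Ωn + Ωφ)⁻¹ * Ωφ).mulVec (γ - xb) = d ⬝ᵥ Ωn *ᵥ d := by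
    have sA : ((Ωn + Ωφ)⁻¹)ᵀ = (Ωn + Ωφ)⁻¹ := by rw [transpose_nonsing_inv, transpose_add, sn, sp]
    have hv : (γ - xb) ᵥ* Ωφ ᵥ* (Ωn + Ωφ)⁻¹ = d := by
      rw [hd, ← mulVec_transpose, sA, ← mulVec_transpose, sp]
    simp only [← mulVec_mulVec]
    rw [← hd, dotProduct_mulVec, dotProduct_mulVec, hv]
  rw [I1, I2, hq]
  ring
end

section
/- Let n ≥ 1, σ > 0, x̄, γ ∈ ℝ and a, b > 0. Set σ_n² = σ²/n and, for i ∈ {a, b}, σ_{φi}² = i²σ²/n, μ̃_i = (x̄·σ_{φi}² + γ·σ_n²)/(σ_{φi}² + σ_n²), σ̃_i² = (σ_{φi}²·σ_n²)/(σ_{φi}² + σ_n²), z_i = (γ − μ̃_i)/σ̃_i. Let Φ and ϕ denote the standard normal cdf and pdf, and define D_a = σ̃_a·exp{−(1/2)(γ/σ_{φa})² + (1/2)(μ̃_a/σ̃_a)²}·Φ(z_a), D_b = σ̃_b·exp{−(1/2)(γ/σ_{φb})² + (1/2)(μ̃_b/σ̃_b)²}·(1 − Φ(z_b)), μ̇_a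 = μ̃_a − σ̃_a·ϕ(z_a)/Φ(z_a), σ̇_a² = σ̃_a²·[1 − z_a·ϕ(z_a)/Φ(z_a) − (ϕ(z_a)/Φ(z_a))²], μ̇_b = μ̃_b + σ̃_b·ϕ(z_b)/(1−Φ(z_b)), σ̇_b² = σ̃_b²·[1 + z_b·ϕ(z_b)/(1−Φ(z_b)) − (ϕ(z_b)/(1−Φ(z_b)))²]. Let π be the density of N(x̄, σ_n²) and let φ be the piecewise weight φ(μ) = C·exp(−(μ−γ)²/(2σ_{φa}²)) for μ ≤ γ and φ(μ) = C·exp(−(μ−γ)²/(2σ_{φb}²)) for μ > γ, with C > 0 such that ∫_ℝ φ·π = 1. Then the information gain satisfies Δ = h(π) − h^φ(π) = 1/2 − [σ̇_a² + (μ̇_a − x̄)²]/(2σ_n²)·D_a/(D_a + D_b) − [σ̇_b² + (μ̇_b − x̄)²]/(2σ_n²)·D_b/(D_a + D_b). -/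
open MeasureTheory

noncomputable def gE (m s t : ℝ) : ℝ := Real.exp (-(t - m) ^ 2 / (2 * s ^ 2))

lemma gE_int (m s : ℝ) (hs : 0 < s) : Integrable (gE m s) := by
  have h := (integrable_exp_neg_mul_sq (b := 1 / (2 * s ^ 2)) (by positivity)).comp_sub_right m
  refine h.congr (Filter.Eventually.of_forall fun t => ?_)
  simp only [gE]; congr 1; field_simp

lemma gE_int1 (m s : ℝ) (hs : 0 < s) : Integrable (fun t => (t - m) * gE m s t) := by
  have h := (integrable_mul_exp_neg_mul_sq (b := 1 / (2 * s ^ 2)) (by positivity)).comp_sub_right m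
  refine h.congr (Filter.Eventually.of_forall fun t => ?_)
  simp only [gE]; congr 2; field_simp

lemma gE_int2 (m s : ℝ) (hs : 0 < s) : Integrable (fun t => (t - m) ^ 2 * gE m s t) := by
  have h := (integrable_rpow_mul_exp_neg_mul_sq (b := 1 / (2 * s ^ 2)) (by positivity)
    (s := 2) (by norm_num)).comp_sub_right m
  refine h.congr (Filter.Eventually.of_forall fun t => ?_)
  simp only [gE, Real.rpow_two]; congr 2; field_simp

lemma gE_int2' (m s x : ℝ) (hs : 0 < s) : Integrable (fun t => (t - x) ^ 2 * gE m s t) := by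
  have h := ((gE_int2 m s hs).add ((gE_int1 m s hs).const_mul (2 * (m - x)))).add
    ((gE_int m s hs).const_mul ((m - x) ^ 2))
  refine h.congr (Filter.Eventually.of_forall fun t => ?_)
  simp only [Pi.add_apply]; ring

noncomputable def gF (m s x t : ℝ) : ℝ := -(s ^ 2) * (t + m - 2 * x) * gE m s t

lemma gF_int (m s x : ℝ) (hs : 0 < s) : Integrable (gF m s x) := by
  have h := ((gE_int1 m s hs).const_mul (-(s ^ 2))).add
    ((gE_int m s hs).const_mul (-(s ^ 2) * (2 * m - 2 * x)))
  refine h.congr (Filter.Eventually.of_forall fun t => ?_)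
  simp only [Pi.add_apply, gF]; ring

noncomputable def gF' (m s x t : ℝ) : ℝ :=
  (t - x) ^ 2 * gE m s t - (s ^ 2 + (m - x) ^ 2) * gE m s t

lemma gF_deriv (m s x : ℝ) (hs : 0 < s) (t : ℝ) :
    HasDerivAt (gF m s x) (gF' m s x t) t := by
  have h1 : HasDerivAt (fun t : ℝ => -(t - m) ^ 2 / (2 * s ^ 2)) (-(2 * (t - m)) / (2 * s ^ 2)) t := by
    have := ((((hasDerivAt_id t).sub_const m).pow 2).neg).div_const (2 * s ^ 2)
    exact this.congr_deriv (by simp)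
  have h2 : HasDerivAt (fun t : ℝ => -(s ^ 2) * (t + m - 2 * x)) (-(s ^ 2) * 1) t :=
    (((hasDerivAt_id t).add_const m).sub_const (2 * x)).const_mul _
  have h3 := h2.mul h1.exp
  refine h3.congr_deriv ?_
  simp only [gF', gE]
  field_simp
  ring

lemma gF'_int (m s x : ℝ) (hs : 0 < s) : Integrable (gF' m s x) :=
  (gE_int2' m s x hs).sub ((gE_int m s hs).const_mul _)

lemma mom_Iic (m s x c : ℝ) (hs : 0 < s) :
    ∫ t in Set.Iic c, (t - x) ^ 2 * gE m s t
      = (s ^ 2 + (m - x) ^ 2) * (∫ t in Set.Iic c, gE m s t) + gF m s x c := by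
  have h0 := tendsto_zero_of_hasDerivAt_of_integrableOn_Iic (a := c)
    (fun t _ => gF_deriv m s x hs t) (gF'_int m s x hs).integrableOn (gF_int m s x hs).integrableOn
  have h1 := integral_Iic_of_hasDerivAt_of_tendsto' (a := c)
    (fun t _ => gF_deriv m s x hs t) (gF'_int m s x hs).integrableOn h0
  simp only [gF'] at h1
  rw [integral_sub (gE_int2' m s x hs).integrableOn ((gE_int m s hs).const_mul _).integrableOn,
    integral_const_mul] at h1
  linarith

lemma mom_Ioi (m s x c : ℝ) (hs : 0 < s) :
    ∫ t in Set.Ioi c, (t - x) ^ 2 * gE m s t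
      = (s ^ 2 + (m - x) ^ 2) * (∫ t in Set.Ioi c, gE m s t) - gF m s x c := by
  have h0 := tendsto_zero_of_hasDerivAt_of_integrableOn_Ioi (a := c)
    (fun t _ => gF_deriv m s x hs t) (gF'_int m s x hs).integrableOn (gF_int m s x hs).integrableOn
  have h1 := integral_Ioi_of_hasDerivAt_of_tendsto' (a := c)
    (fun t _ => gF_deriv m s x hs t) (gF'_int m s x hs).integrableOn h0
  simp only [gF'] at h1
  rw [integral_sub (gE_int2' m s x hs).integrableOn ((gE_int m s hs).const_mul _).integrableOn,
    integral_const_mul] at h1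
  linarith

lemma split_int (c : ℝ) (g : ℝ → ℝ) (hg : Integrable g) :
    ∫ t, g t = (∫ t in Set.Iic c, g t) + ∫ t in Set.Ioi c, g t := by
  rw [← Set.compl_Iic, integral_add_compl measurableSet_Iic hg]

lemma gE_total (m s : ℝ) (hs : 0 < s) : ∫ t, gE m s t = s * Real.sqrt (2 * Real.pi) := by
  have h := integral_sub_right_eq_self (μ := volume)
    (fun t : ℝ => Real.exp (-(1 / (2 * s ^ 2)) * t ^ 2)) m
  rw [integral_gaussian] at h
  have h2 : Real.pi / (1 / (2 * s ^ 2)) = s ^ 2 * (2 * Real.pi) := by field_simp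
  rw [h2, Real.sqrt_mul (by positivity), Real.sqrt_sq hs.le] at h
  rw [← h]
  congr 1; ext t
  simp only [gE]; congr 1; field_simp

lemma mom_total (m s x : ℝ) (hs : 0 < s) :
    ∫ t, (t - x) ^ 2 * gE m s t = (s ^ 2 + (m - x) ^ 2) * (s * Real.sqrt (2 * Real.pi)) := by
  rw [split_int 0 _ (gE_int2' m s x hs), mom_Iic m s x 0 hs, mom_Ioi m s x 0 hs,
    ← gE_total m s hs, split_int 0 _ (gE_int m s hs)]
  ring

lemma gE_Ioi (m s c : ℝ) (hs : 0 < s) :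
    ∫ t in Set.Ioi c, gE m s t = s * ∫ t in Set.Ioi ((c - m) / s), gE 0 1 t := by
  have h1 : ∫ t in Set.Ioi ((c - m) / s), gE m s (s * t + m) = ∫ t in Set.Ioi ((c - m) / s), gE 0 1 t := by
    congr 1; ext t; simp only [gE]; congr 1; field_simp; ring
  have h2 := integral_comp_mul_left_Ioi (fun u => gE m s (u + m)) ((c - m) / s) hs
  have h3 : s * ((c - m) / s) = c - m := by field_simp
  rw [h3] at h2
  have h4 : ∫ t in Set.Ioi (c - m), gE m s (t + m) = ∫ t in Set.Ioi c, gE m s t := by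
    have := (measurePreserving_add_right (volume : Measure ℝ) m).setIntegral_preimage_emb
      (measurableEmbedding_addRight m) (gE m s) (Set.Ioi c)
    simpa using this
  rw [← h1, h2, h4, smul_eq_mul]
  field_simp

lemma gE_Iic (m s c : ℝ) (hs : 0 < s) :
    ∫ t in Set.Iic c, gE m s t = s * ∫ t in Set.Iic ((c - m) / s), gE 0 1 t := by
  have h1 := split_int c _ (gE_int m s hs)
  have h2 := split_int ((c - m) / s) _ (gE_int 0 1 one_pos)
  rw [gE_total _ _ hs, gE_Ioi m s c hs] at h1
  rw [gE_total _ _ one_pos] at h2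
  linear_combination -h1 + s * h2

lemma gE_pos_Iic (m s c : ℝ) (hs : 0 < s) : 0 < ∫ t in Set.Iic c, gE m s t := by
  have : NeZero (volume.restrict (Set.Iic c)) := ⟨by simp⟩
  exact integral_exp_pos (gE_int m s hs).integrableOn

lemma gE_pos_Ioi (m s c : ℝ) (hs : 0 < s) : 0 < ∫ t in Set.Ioi c, gE m s t := by
  have : NeZero (volume.restrict (Set.Ioi c)) := ⟨by simp⟩
  exact integral_exp_pos (gE_int m s hs).integrableOn

/-- Completing the square. -/
lemma sq_complete (v p γ xb m s t : ℝ) (hv : 0 < v) (hp : 0 < p)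
    (hm : m = (xb * p + γ * v) / (p + v)) (hs : s = Real.sqrt (p * v / (p + v))) :
    Real.exp (-(t - γ) ^ 2 / (2 * p)) * Real.exp (-(t - xb) ^ 2 / (2 * v))
      = Real.exp (-(1 / 2) * (γ ^ 2 / p) + 1 / 2 * (m ^ 2 / s ^ 2)) *
        Real.exp (-xb ^ 2 / (2 * v)) * gE m s t := by
  have hs2 : s ^ 2 = p * v / (p + v) := by rw [hs, Real.sq_sqrt (by positivity)]
  have : p + v ≠ 0 := by positivity
  simp only [gE]
  rw [← Real.exp_add, ← Real.exp_add, ← Real.exp_add, hs2, hm]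
  congr 1
  field_simp
  ring

/-- Theorem 3 of the paper (SM): closed-form information gain for the asymmetric
piecewise-Gaussian weight function, whose left piece (for `μ ≤ γ`) has variance
`a²σ²/n` and right piece (for `μ > γ`) has variance `b²σ²/n`. -/
theorem information_gain_asymmetric_weight
    (n : ℕ) (hn : 1 ≤ n) (σ xb γ a b : ℝ) (hσ : 0 < σ) (ha : 0 < a) (hb : 0 < b)
    (σn2 σφa2 σφb2 : ℝ)
    (hσn2 : σn2 = σ ^ 2 / n)
    (hσφa2 : σφa2 = a ^ 2 * σ ^ 2 / n)
    (hσφb2 : σφb2 = b ^ 2 * σ ^ 2 / n)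
    (μta μtb σta σtb za zb : ℝ)
    (hμta : μta = (xb * σφa2 + γ * σn2) / (σφa2 + σn2))
    (hμtb : μtb = (xb * σφb2 + γ * σn2) / (σφb2 + σn2))
    (hσta : σta = Real.sqrt (σφa2 * σn2 / (σφa2 + σn2)))
    (hσtb : σtb = Real.sqrt (σφb2 * σn2 / (σφb2 + σn2)))
    (hza : za = (γ - μta) / σta)
    (hzb : zb = (γ - μtb) / σtb)
    (Φ φpdf : ℝ → ℝ)
    (hφpdf : ∀ z : ℝ, φpdf z = (2 * Real.pi) ^ (-(1 / 2) : ℝ) * Real.exp (-z ^ 2 / 2))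
    (hΦ : ∀ z : ℝ, Φ z = ∫ t in Set.Iic z, φpdf t)
    (Da Db : ℝ)
    (hDa : Da = σta * Real.exp (-(1 / 2) * (γ ^ 2 / σφa2) + 1 / 2 * (μta ^ 2 / σta ^ 2)) * Φ za)
    (hDb : Db = σtb * Real.exp (-(1 / 2) * (γ ^ 2 / σφb2) + 1 / 2 * (μtb ^ 2 / σtb ^ 2))
      * (1 - Φ zb))
    (μda σda2 μdb σdb2 : ℝ)
    (hμda : μda = μta - σta * (φpdf za / Φ za))
    (hσda2 : σda2 = σta ^ 2 * (1 - za * φpdf za / Φ za - (φpdf za / Φ za) ^ 2))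
    (hμdb : μdb = μtb + σtb * (φpdf zb / (1 - Φ zb)))
    (hσdb2 : σdb2 = σtb ^ 2 * (1 + zb * φpdf zb / (1 - Φ zb) - (φpdf zb / (1 - Φ zb)) ^ 2))
    (f : ℝ → ℝ)
    (hf : ∀ μ : ℝ, f μ =
      (2 * Real.pi * σn2) ^ (-(1 / 2) : ℝ) * Real.exp (-(μ - xb) ^ 2 / (2 * σn2)))
    (C : ℝ) (hC : 0 < C)
    (w : ℝ → ℝ)
    (hw : ∀ μ : ℝ, w μ = if μ ≤ γ then C * Real.exp (-(μ - γ) ^ 2 / (2 * σφa2))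
      else C * Real.exp (-(μ - γ) ^ 2 / (2 * σφb2)))
    (hnorm : ∫ μ : ℝ, w μ * f μ = 1) :
    (-∫ μ : ℝ, f μ * Real.log (f μ)) - (-∫ μ : ℝ, w μ * f μ * Real.log (f μ))
      = 1 / 2 - (σda2 + (μda - xb) ^ 2) / (2 * σn2) * (Da / (Da + Db))
          - (σdb2 + (μdb - xb) ^ 2) / (2 * σn2) * (Db / (Da + Db)) := by
  have hn0 : (0 : ℝ) < n := by exact_mod_cast hn
  have hv : 0 < σn2 := by rw [hσn2]; positivity
  have hpa : 0 < σφa2 := by rw [hσφa2]; positivity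
  have hpb : 0 < σφb2 := by rw [hσφb2]; positivity
  have hsa : 0 < σta := by rw [hσta]; positivity
  have hsb : 0 < σtb := by rw [hσtb]; positivity
  clear hσn2 hσφa2 hσφb2
  set R := Real.sqrt (2 * Real.pi) with hR
  have hR0 : 0 < R := by rw [hR]; positivity
  have hRinv : (2 * Real.pi) ^ (-(1 / 2) : ℝ) = R⁻¹ := by
    rw [Real.rpow_neg (by positivity), hR, Real.sqrt_eq_rpow]
  have hφ' : ∀ z, φpdf z = R⁻¹ * gE 0 1 z := by
    intro z; rw [hφpdf, hRinv, gE]; simp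
  have hΦ' : ∀ z, Φ z = R⁻¹ * ∫ t in Set.Iic z, gE 0 1 t := by
    intro z; rw [hΦ, ← integral_const_mul]; simp only [hφ']
  have hΦ1 : ∀ z, 1 - Φ z = R⁻¹ * ∫ t in Set.Ioi z, gE 0 1 t := by
    intro z
    have h2 := split_int z _ (gE_int 0 1 one_pos)
    rw [gE_total _ _ one_pos, ← hR] at h2
    rw [hΦ']
    have : R⁻¹ * R = 1 := by field_simp
    linear_combination R⁻¹ * h2 - this
  have hΦpos : 0 < Φ za := by
    rw [hΦ']; exact mul_pos (inv_pos.2 hR0) (gE_pos_Iic _ _ _ one_pos)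
  have hΨpos : 0 < 1 - Φ zb := by
    rw [hΦ1]; exact mul_pos (inv_pos.2 hR0) (gE_pos_Ioi _ _ _ one_pos)
  have gz : ∀ m s, 0 < s → gE m s γ = R * φpdf ((γ - m) / s) := by
    intro m s hs
    rw [hφ', ← mul_assoc, mul_inv_cancel₀ hR0.ne', one_mul]
    simp only [gE]; congr 1; field_simp; ring
  -- zeroth moments
  have ia0 : ∫ t in Set.Iic γ, gE μta σta t = σta * R * Φ za := by
    rw [gE_Iic _ _ _ hsa, ← hza, hΦ']; field_simp
  have ib0 : ∫ t in Set.Ioi γ, gE μtb σtb t = σtb * R * (1 - Φ zb) := by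
    rw [gE_Ioi _ _ _ hsb, ← hzb, hΦ1]; field_simp
  -- second moments
  have ia2 : ∫ t in Set.Iic γ, (t - xb) ^ 2 * gE μta σta t
      = (σda2 + (μda - xb) ^ 2) * (σta * R * Φ za) := by
    have hg : γ = σta * za + μta := by rw [hza]; field_simp; ring
    rw [mom_Iic _ _ _ _ hsa, ia0, gF, gz _ _ hsa, ← hza, hσda2, hμda, hg]
    field_simp
    ring
  have ib2 : ∫ t in Set.Ioi γ, (t - xb) ^ 2 * gE μtb σtb t
      = (σdb2 + (μdb - xb) ^ 2) * (σtb * R * (1 - Φ zb)) := by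
    have hg : γ = σtb * zb + μtb := by rw [hzb]; field_simp; ring
    rw [mom_Ioi _ _ _ _ hsb, ib0, gF, gz _ _ hsb, ← hzb, hσdb2, hμdb, hg]
    generalize 1 - Φ zb = Ψ at *
    field_simp
    ring
  set K := (2 * Real.pi * σn2) ^ (-(1 / 2) : ℝ) with hK
  have hK0 : 0 < K := by rw [hK]; positivity
  set sn := Real.sqrt σn2 with hsn
  have hsn0 : 0 < sn := by rw [hsn]; positivity
  have hsn2 : sn ^ 2 = σn2 := Real.sq_sqrt hv.le
  have hKR : K * (sn * R) = 1 := by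
    rw [hK, Real.rpow_neg (by positivity), ← Real.sqrt_eq_rpow, Real.sqrt_mul (by positivity),
      ← hR, ← hsn]
    field_simp
  have hfE : ∀ t, f t = K * gE xb sn t := by
    intro t; rw [hf, gE, hsn2]
  have hlog : ∀ t, Real.log (f t) = Real.log K - 1 / (2 * σn2) * (t - xb) ^ 2 := by
    intro t
    rw [hf, Real.log_mul hK0.ne' (Real.exp_ne_zero _), Real.log_exp]; ring
  -- entropy of the posterior
  have hent : ∫ t, f t * Real.log (f t) = Real.log K - 1 / 2 := by
    have e : ∀ t, f t * Real.log (f t) = (Real.log K * K) * gE xb sn t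
        - (1 / (2 * σn2) * K) * ((t - xb) ^ 2 * gE xb sn t) := by
      intro t; rw [hlog, hfE]; ring
    simp only [e]
    rw [integral_sub ((gE_int _ _ hsn0).const_mul _) ((gE_int2' _ _ _ hsn0).const_mul _),
      integral_const_mul, integral_const_mul, gE_total _ _ hsn0, mom_total _ _ _ hsn0, ← hR, hsn2]
    have h2 : 1 / (2 * σn2) * σn2 = 1 / 2 := by field_simp
    linear_combination (Real.log K - 1 / (2 * σn2) * σn2) * hKR - h2
  -- the weighted density on both sides
  set Ea := Real.exp (-(1 / 2) * (γ ^ 2 / σφa2) + 1 / 2 * (μta ^ 2 / σta ^ 2)) with hEa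
  set Eb := Real.exp (-(1 / 2) * (γ ^ 2 / σφb2) + 1 / 2 * (μtb ^ 2 / σtb ^ 2)) with hEb
  set Q := Real.exp (-xb ^ 2 / (2 * σn2)) with hQ
  have hwa : ∀ t ∈ Set.Iic γ, w t * f t = (C * K * Q * Ea) * gE μta σta t := by
    intro t ht
    have h := sq_complete σn2 σφa2 γ xb μta σta t hv hpa hμta hσta
    rw [← hEa, ← hQ] at h
    rw [hw, hf, if_pos (Set.mem_Iic.1 ht)]
    linear_combination C * K * h
  have hwb : ∀ t ∈ Set.Ioi γ, w t * f t = (C * K * Q * Eb) * gE μtb σtb t := by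
    intro t ht
    have h := sq_complete σn2 σφb2 γ xb μtb σtb t hv hpb hμtb hσtb
    rw [← hEb, ← hQ] at h
    rw [hw, hf, if_neg (not_le.2 (Set.mem_Ioi.1 ht))]
    linear_combination C * K * h
  have hwa2 : ∀ t ∈ Set.Iic γ, (t - xb) ^ 2 * (w t * f t)
      = (C * K * Q * Ea) * ((t - xb) ^ 2 * gE μta σta t) := by
    intro t ht; rw [hwa t ht]; ring
  have hwb2 : ∀ t ∈ Set.Ioi γ, (t - xb) ^ 2 * (w t * f t)
      = (C * K * Q * Eb) * ((t - xb) ^ 2 * gE μtb σtb t) := by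
    intro t ht; rw [hwb t ht]; ring
  have hint : Integrable (fun t => w t * f t) := by
    rw [← integrableOn_univ, ← Set.Iic_union_Ioi (a := γ)]
    exact (((gE_int _ _ hsa).const_mul _).integrableOn.congr_fun
      (fun t ht => (hwa t ht).symm) measurableSet_Iic).union
      (((gE_int _ _ hsb).const_mul _).integrableOn.congr_fun
      (fun t ht => (hwb t ht).symm) measurableSet_Ioi)
  have hint2 : Integrable (fun t => (t - xb) ^ 2 * (w t * f t)) := by
    rw [← integrableOn_univ, ← Set.Iic_union_Ioi (a := γ)]
    exact (((gE_int2' _ _ _ hsa).const_mul _).integrableOn.congr_fun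
      (fun t ht => (hwa2 t ht).symm) measurableSet_Iic).union
      (((gE_int2' _ _ _ hsb).const_mul _).integrableOn.congr_fun
      (fun t ht => (hwb2 t ht).symm) measurableSet_Ioi)
  have hM : C * K * Q * R * (Da + Db) = 1 := by
    rw [← hnorm, split_int γ _ hint, setIntegral_congr_fun measurableSet_Iic hwa,
      setIntegral_congr_fun measurableSet_Ioi hwb, integral_const_mul, integral_const_mul,
      ia0, ib0, hDa, hDb]
    ring
  have hM2 : ∫ t, (t - xb) ^ 2 * (w t * f t) = C * K * Q * R *
      ((σda2 + (μda - xb) ^ 2) * Da + (σdb2 + (μdb - xb) ^ 2) * Db) := by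
    rw [split_int γ _ hint2, setIntegral_congr_fun measurableSet_Iic hwa2,
      setIntegral_congr_fun measurableSet_Ioi hwb2, integral_const_mul, integral_const_mul,
      ia2, ib2, hDa, hDb]
    ring
  have hwent : ∫ t, w t * f t * Real.log (f t) = Real.log K - 1 / (2 * σn2) * (C * K * Q * R *
      ((σda2 + (μda - xb) ^ 2) * Da + (σdb2 + (μdb - xb) ^ 2) * Db)) := by
    have e : ∀ t, w t * f t * Real.log (f t) = Real.log K * (w t * f t)
        - (1 / (2 * σn2)) * ((t - xb) ^ 2 * (w t * f t)) := by
      intro t; rw [hlog]; ring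
    simp only [e]
    rw [integral_sub (hint.const_mul _) (hint2.const_mul _),
      integral_const_mul, integral_const_mul, hnorm, hM2, mul_one]
  have hD : Da + Db ≠ 0 := right_ne_zero_of_mul_eq_one hM
  have hM' : C * K * Q * R = 1 / (Da + Db) := by field_simp; linarith
  rw [hent, hwent, hM']
  field_simp
  ring
end
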